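/- arXiv:1304.4309 — 4 statements merged into one kernel-verified Lean document; each statement's English description precedes it below -/
import Mathlib

section
/- Let α_n denote the unique positive real solution of u·e^u = n+1. There is a constant C > 0 such that for all n ≥ 2, the mean of the dimension exponent over uniform random set partitions of [n] satisfies |(1/B_n)·Σ_{λ ∈ Π(n)} d(λ) − ((α_n − 2)/α_n^2)·n^2| ≤ C·n/α_n. -/
open Finset

/-- Set partitions of `[n]`, modeled as finpartitions of `Fin n`. -/
abbrev SetPartition (n : ℕ) := Finpartition (Finset.univ : Finset (Fin n))

/-- The `n`-th Bell number: the number of set partitions of `[n]`. -/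
def bell (n : ℕ) : ℕ := Fintype.card (SetPartition n)

/-- `i` and `j` lie in the same block of the partition. -/
def SameBlock {n : ℕ} (P : SetPartition n) (i j : Fin n) : Prop :=
  ∃ b ∈ P.parts, i ∈ b ∧ j ∈ b

/-- `i` is the smallest element of its block. -/
def IsFirst {n : ℕ} (P : SetPartition n) (i : Fin n) : Prop :=
  ∀ j, SameBlock P i j → i ≤ j

/-- `i` is the largest element of its block. -/
def IsLast {n : ℕ} (P : SetPartition n) (i : Fin n) : Prop :=
  ∀ j, SameBlock P i j → j ≤ i

/-- `(i, j)` is an arc: `i < j`, both in the same block, and `j` is the smallest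
element of that block greater than `i`. -/
def IsArc {n : ℕ} (P : SetPartition n) (i j : Fin n) : Prop :=
  i < j ∧ SameBlock P i j ∧ ∀ k, i < k → k < j → ¬ SameBlock P i k

/-- The dimension exponent `d(λ) = Σ_blocks (max - min + 1) - n`. -/
def dimExp {n : ℕ} (P : SetPartition n) : ℤ :=
  (∑ b ∈ P.parts.attach,
      (((b.1.max' (P.nonempty_of_mem_parts b.2)).val : ℤ)
        - ((b.1.min' (P.nonempty_of_mem_parts b.2)).val : ℤ) + 1)) - n

/-- The intertwining exponent (number of 2-crossings): the number of pairs of arcs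
`(i₁,j₁), (i₂,j₂)` with `i₁ < i₂ < j₁ < j₂`. -/
noncomputable def inter {n : ℕ} (P : SetPartition n) : ℕ :=
  Set.ncard {q : (Fin n × Fin n) × (Fin n × Fin n) |
    IsArc P q.1.1 q.1.2 ∧ IsArc P q.2.1 q.2.2 ∧
    q.1.1 < q.2.1 ∧ q.2.1 < q.1.2 ∧ q.1.2 < q.2.2}

/-- Weighted Chebyshev sum inequality. -/
theorem sum_mul_sum_le_sum_mul_sum_of_antitone {n : ℕ} {w x y : ℕ → ℝ}
    (hw : ∀ j < n, 0 ≤ w j)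
    (hx : ∀ i j, i ≤ j → j < n → x j ≤ x i) (hy : ∀ i j, i ≤ j → j < n → y j ≤ y i) :
    (∑ j ∈ range n, w j * x j) * (∑ j ∈ range n, w j * y j) ≤
      (∑ j ∈ range n, w j) * (∑ j ∈ range n, w j * (x j * y j)) := by
  have h : 0 ≤ ∑ i ∈ range n, ∑ j ∈ range n, w i * w j * ((x i - x j) * (y i - y j)) := by
    refine sum_nonneg fun i hi => sum_nonneg fun j hj => ?_
    rw [mem_range] at hi hj
    refine mul_nonneg (mul_nonneg (hw i hi) (hw j hj)) ?_
    rcases le_total i j with hij | hij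
    · exact mul_nonneg (sub_nonneg.2 (hx i j hij hj)) (sub_nonneg.2 (hy i j hij hj))
    · exact mul_nonneg_of_nonpos_of_nonpos (sub_nonpos.2 (hx j i hij hi))
        (sub_nonpos.2 (hy j i hij hi))
  have e : ∑ i ∈ range n, ∑ j ∈ range n, w i * w j * ((x i - x j) * (y i - y j)) =
      2 * ((∑ j ∈ range n, w j) * (∑ j ∈ range n, w j * (x j * y j)) -
        (∑ j ∈ range n, w j * x j) * (∑ j ∈ range n, w j * y j)) := by
    have e1 : ∀ i j, w i * w j * ((x i - x j) * (y i - y j)) =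
        (w i * (x i * y i)) * w j + w i * (w j * (x j * y j))
          - (w i * x i) * (w j * y j) - (w i * y i) * (w j * x j) := fun i j => by ring
    simp only [e1, sum_sub_distrib, sum_add_distrib, ← Finset.sum_mul_sum]
    ring
  linarith

/-- The sequence `b` consists of the coefficients of `exp (exp x - 1)`. -/
structure IsBellCoeff (b : ℕ → ℝ) : Prop where
  zero : b 0 = 1
  succ : ∀ m : ℕ, (m + 1 : ℝ) * b (m + 1) = ∑ k ∈ range (m + 1), b (m - k) / (k.factorial : ℝ)

namespace IsBellCoeff

variable {b : ℕ → ℝ}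

theorem pos (hb : IsBellCoeff b) (n : ℕ) : 0 < b n := by
  induction n using Nat.strong_induction_on with
  | _ n ih =>
    rcases n with _ | m
    · rw [hb.zero]; exact one_pos
    · have h := hb.succ m
      have : 0 < ∑ k ∈ range (m + 1), b (m - k) / (k.factorial : ℝ) :=
        sum_pos (fun k _ => div_pos (ih _ (by omega)) (by positivity)) ⟨0, by simp⟩
      rw [← h] at this
      exact pos_of_mul_pos_right this (by positivity)

theorem one (hb : IsBellCoeff b) : b 1 = 1 := by
  have := hb.succ 0
  simpa [hb.zero] using this

theorem two (hb : IsBellCoeff b) : b 2 = 1 := by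
  have := hb.succ 1
  norm_num [sum_range_succ, hb.zero, hb.one] at this
  linarith

/-- Log-concavity at one index, given log-concavity at all smaller ones. -/
theorem ratio_step (hb : IsBellCoeff b) (n : ℕ)
    (ih : ∀ i j, i ≤ j → j ≤ n → b (j + 1) / b j ≤ b (i + 1) / b i) :
    b (n + 2) / b (n + 1) ≤ b (n + 1) / b n := by
  have hp := hb.pos
  rcases n with _ | m
  · simp [hb.zero, hb.one, hb.two]
  set w : ℕ → ℝ := fun j => b (m + 1 - j) / (j.factorial : ℝ) with hw
  set x : ℕ → ℝ := fun j => 1 / ((j : ℝ) + 1) with hx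
  set y : ℕ → ℝ := fun j => if j ≤ m then b (m - j) / b (m + 1 - j) else 0 with hy
  have key := sum_mul_sum_le_sum_mul_sum_of_antitone (n := m + 2) (w := w) (x := x) (y := y)
    (fun j _ => div_nonneg (hp _).le (by positivity))
    (fun i j hij _ => by
      simp only [hx]
      have : (i : ℝ) ≤ j := by exact_mod_cast hij
      gcongr)
    (fun i j hij hj => by
      simp only [hy]
      by_cases hjm : j ≤ m
      · rw [if_pos hjm, if_pos (hij.trans hjm)]
        have h := ih (m - j) (m - i) (by omega) (by omega)
        rw [show m - j + 1 = m + 1 - j by omega, show m - i + 1 = m + 1 - i by omega] at h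
        have h' := inv_anti₀ (div_pos (hp _) (hp _)) h
        simpa [inv_div] using h'
      · rw [if_neg hjm]
        split_ifs
        · exact (div_pos (hp _) (hp _)).le
        · exact le_rfl)
  have s0 : ∑ j ∈ range (m + 2), w j = (m + 2 : ℝ) * b (m + 2) := by
    have := hb.succ (m + 1)
    push_cast at this
    rw [← this]; ring
  have wx : ∀ j, w j * x j = b (m + 1 - j) / ((j + 1).factorial : ℝ) := fun j => by
    simp only [hw, hx, Nat.factorial_succ]
    push_cast
    field_simp
  have s2 : ∑ j ∈ range (m + 2), w j * x j = (m + 3 : ℝ) * b (m + 3) - b (m + 2) := by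
    have := hb.succ (m + 2)
    rw [sum_range_succ'] at this
    simp only [wx]
    push_cast at this
    simp only [Nat.factorial_zero, Nat.cast_one, div_one] at this
    rw [show (m + 3 : ℝ) = m + 2 + 1 by ring, this, add_sub_cancel_right]
  have wy : ∀ j ∈ range (m + 1), w j * y j = b (m - j) / (j.factorial : ℝ) := fun j hj => by
    rw [mem_range] at hj
    simp only [hw, hy, if_pos (show j ≤ m by omega)]
    have := (hp (m + 1 - j)).ne'
    field_simp
  have y_last : y (m + 1) = 0 := by simp [hy]
  have s1 : ∑ j ∈ range (m + 2), w j * y j = (m + 1 : ℝ) * b (m + 1) := by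
    rw [sum_range_succ, y_last, mul_zero, add_zero, sum_congr rfl wy, ← hb.succ m]
  have s3 : ∑ j ∈ range (m + 2), w j * (x j * y j) = (m + 2 : ℝ) * b (m + 2) - b (m + 1) := by
    rw [← s0, sum_range_succ, y_last, mul_zero, mul_zero, add_zero, sum_range_succ' w]
    have : w 0 = b (m + 1) := by simp [hw]
    rw [this, add_sub_cancel_right]
    refine sum_congr rfl fun j hj => ?_
    rw [show w j * (x j * y j) = (w j * y j) * x j by ring, wy j hj]
    simp only [hw, hx, Nat.factorial_succ, show m + 1 - (j + 1) = m - j by omega]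
    push_cast
    field_simp
  rw [s0, s1, s2, s3] at key
  have hle : b (m + 2) ≤ b (m + 1) := by
    have := ih 0 (m + 1) (by omega) le_rfl
    rw [hb.zero, zero_add, hb.one, div_one, div_le_one (hp _)] at this
    exact this
  rw [div_le_div_iff₀ (hp _) (hp _)]
  have h1 := hp (m + 1)
  have h2 := hp (m + 2)
  have h4 : (0 : ℝ) < ((m : ℝ) + 1) * (m + 3) := by positivity
  have h3 : 0 ≤ b (m + 2) * (b (m + 1) - b (m + 2)) :=
    mul_nonneg h2.le (sub_nonneg.2 hle)
  have h5 : ((m : ℝ) + 1) * (m + 3) * (b (m + 3) * b (m + 1)) ≤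
      ((m : ℝ) + 1) * (m + 3) * (b (m + 2) * b (m + 2)) := by nlinarith
  exact le_of_mul_le_mul_left h5 h4

theorem ratio_anti (hb : IsBellCoeff b) : Antitone fun n => b (n + 1) / b n := by
  have h : ∀ n, ∀ i j, i ≤ j → j ≤ n → b (j + 1) / b j ≤ b (i + 1) / b i := by
    intro n
    induction n with
    | zero =>
      intro i j hij hj
      obtain rfl : j = 0 := by omega
      obtain rfl : i = 0 := by omega
      exact le_rfl
    | succ n ih =>
      intro i j hij hj
      rcases Nat.lt_or_ge n j with h | h
      · obtain rfl : j = n + 1 := by omega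
        rcases Nat.lt_or_ge n i with h' | h'
        · obtain rfl : i = n + 1 := by omega
          exact le_rfl
        · exact (hb.ratio_step n ih).trans (ih i n h' le_rfl)
      · exact ih i j hij h
  exact fun i j hij => h j i j hij le_rfl

/-- `∑ j b_{n-j} / j! = n b_n`. -/
theorem sum_mul_div_factorial (hb : IsBellCoeff b) (n : ℕ) :
    ∑ j ∈ range (n + 1), (j : ℝ) * (b (n - j) / (j.factorial : ℝ)) = n * b n := by
  rcases n with _ | m
  · simp
  · rw [sum_range_succ']
    have := hb.succ m
    push_cast
    rw [this]
    simp only [zero_mul, add_zero]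
    refine sum_congr rfl fun j _ => ?_
    rw [Nat.factorial_succ]
    push_cast
    field_simp

theorem sum_mul_succ_div_factorial (hb : IsBellCoeff b) (n : ℕ) :
    ∑ j ∈ range (n + 1), ((n : ℝ) + 1 - j) * (b (n - j + 1) / (j.factorial : ℝ)) =
      (n + 1) * (n + 2) * b (n + 2) - (n + 1) * b (n + 1) := by
  have h1 := hb.succ (n + 1)
  have h2 := hb.sum_mul_div_factorial (n + 1)
  push_cast at h1 h2
  have h3 : ∑ j ∈ range (n + 2), ((n : ℝ) + 1 - j) * (b (n + 1 - j) / (j.factorial : ℝ)) =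
      (n + 1) * ((n + 1 + 1) * b (n + 2)) - (n + 1) * b (n + 1) := by
    rw [h1, ← h2, mul_sum, ← sum_sub_distrib]
    exact sum_congr rfl fun j _ => by ring
  rw [sum_range_succ] at h3
  push_cast at h3
  rw [sub_self, zero_mul, add_zero] at h3
  rw [show (n + 1) * (n + 2) * b (n + 2) - (n + 1) * b (n + 1) =
    (n + 1) * ((n + 1 + 1) * b (n + 2)) - (n + 1) * b (n + 1) by ring, ← h3]
  refine sum_congr rfl fun j hj => ?_
  rw [mem_range] at hj
  rw [show n - j + 1 = n + 1 - j by omega]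

/-- The exact value of a weighted sum of the increments of the ratios `b_{m+1} / b_m`. -/
theorem sum_ratio_sub (hb : IsBellCoeff b) (n : ℕ) :
    ∑ j ∈ range (n + 1), b (n - j) / (j.factorial : ℝ) *
        (((n : ℝ) + 1 - j) * (b (n - j + 1) / b (n - j) / (b (n + 1) / b n) - 1)) =
      (n + 1) * (n + 2) * b n * (b (n + 2) / b (n + 1)) - b n - (n + 1) ^ 2 * b (n + 1) := by
  have hp := hb.pos
  have e : ∀ j, b (n - j) / (j.factorial : ℝ) *
        (((n : ℝ) + 1 - j) * (b (n - j + 1) / b (n - j) / (b (n + 1) / b n) - 1)) =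
      b n / b (n + 1) * (((n : ℝ) + 1 - j) * (b (n - j + 1) / (j.factorial : ℝ)))
        - (n + 1) * (b (n - j) / (j.factorial : ℝ)) + j * (b (n - j) / (j.factorial : ℝ)) := by
    intro j
    have h1 := (hp (n - j)).ne'
    have h2 := (hp n).ne'
    have h3 := (hp (n + 1)).ne'
    field_simp
    ring
  simp only [e, sum_add_distrib, sum_sub_distrib, ← mul_sum]
  rw [hb.sum_mul_succ_div_factorial, hb.sum_mul_div_factorial, ← hb.succ n]
  have h3 := (hp (n + 1)).ne'
  field_simp
  ring

theorem ratio_sub_nonneg (hb : IsBellCoeff b) (n j : ℕ) :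
    0 ≤ b (n - j + 1) / b (n - j) / (b (n + 1) / b n) - 1 := by
  rw [sub_nonneg, one_le_div (div_pos (hb.pos _) (hb.pos _))]
  exact hb.ratio_anti (Nat.sub_le n j)

theorem sum_ratio_sub_le (hb : IsBellCoeff b) (n : ℕ) :
    ∑ j ∈ range (n + 1), b (n - j) / (j.factorial : ℝ) *
        (((n : ℝ) + 1 - j) * (b (n - j + 1) / b (n - j) / (b (n + 1) / b n) - 1)) ≤
      (n + 1) * b (n + 1) := by
  rw [hb.sum_ratio_sub]
  have h := hb.ratio_anti (Nat.le_succ n)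
  have hp := hb.pos n
  simp only at h
  have h1 : (n + 1) * (n + 2) * b n * (b (n + 2) / b (n + 1)) ≤
      (n + 1) * (n + 2) * b n * (b (n + 1) / b n) := by gcongr
  have h2 : (n + 1) * (n + 2) * b n * (b (n + 1) / b n) = (n + 1) * (n + 2) * b (n + 1) := by
    field_simp
  nlinarith

/-- The ratios `B_{n+1} / B_n` of Bell numbers increase. -/
theorem bellRatio_mono (hb : IsBellCoeff b) :
    Monotone fun n : ℕ => ((n : ℝ) + 1) * (b (n + 1) / b n) := by
  refine monotone_nat_of_le_succ fun n => ?_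
  have h0 : 0 ≤ ∑ j ∈ range (n + 1), b (n - j) / (j.factorial : ℝ) *
        (((n : ℝ) + 1 - j) * (b (n - j + 1) / b (n - j) / (b (n + 1) / b n) - 1)) := by
    refine sum_nonneg fun j hj => mul_nonneg (div_nonneg (hb.pos _).le (by positivity))
      (mul_nonneg ?_ (hb.ratio_sub_nonneg n j))
    rw [mem_range] at hj
    have : (j : ℝ) + 1 ≤ n + 1 := by exact_mod_cast hj
    linarith
  rw [hb.sum_ratio_sub] at h0
  have hp := hb.pos n
  have h2 : b (n + 1) = b n * (b (n + 1) / b n) := by field_simp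
  set x := b (n + 1) / b n
  set y := b (n + 2) / b (n + 1)
  rw [h2] at h0
  have h3 : 0 ≤ ((n : ℝ) + 1) * b n * ((n + 2) * y - (n + 1) * x) := by nlinarith
  have h4 := nonneg_of_mul_nonneg_right h3 (by positivity)
  push_cast
  linarith

end IsBellCoeff

/-- A bound for the tail of the exponential series. -/
theorem exp_le_sum_range_add {x : ℝ} (hx : 0 ≤ x) (k : ℕ) :
    Real.exp x ≤ ∑ j ∈ range (k + 3), x ^ j / (j.factorial : ℝ) +
      x ^ 3 / ((k + 1) * (k + 2) * (k + 3)) * Real.exp x := by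
  have hs := Real.summable_pow_div_factorial x
  have he : ∑' j : ℕ, x ^ j / (j.factorial : ℝ) = Real.exp x := by
    rw [Real.exp_eq_exp_ℝ, NormedSpace.exp_eq_tsum_div]
  have h1 := hs.sum_add_tsum_nat_add (k + 3)
  have h2 := hs.sum_add_tsum_nat_add k
  have h3 : 0 ≤ ∑ j ∈ range k, x ^ j / (j.factorial : ℝ) :=
    sum_nonneg fun j _ => by positivity
  have h4 : ∑' j : ℕ, x ^ (j + (k + 3)) / ((j + (k + 3)).factorial : ℝ) ≤
      x ^ 3 / ((k + 1) * (k + 2) * (k + 3)) * ∑' j : ℕ, x ^ (j + k) / ((j + k).factorial : ℝ) := by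
    rw [← tsum_mul_left]
    refine Summable.tsum_le_tsum (fun j => ?_) ((summable_nat_add_iff _).2 hs)
      (((summable_nat_add_iff _).2 hs).mul_left _)
    have e : ((j + (k + 3)).factorial : ℝ) =
        ((j + k + 1) * (j + k + 2) * (j + k + 3)) * ((j + k).factorial : ℝ) := by
      rw [show j + (k + 3) = j + k + 1 + 1 + 1 by ring]
      simp only [Nat.factorial_succ]
      push_cast
      ring
    rw [e, div_mul_div_comm, ← pow_add, show 3 + (j + k) = j + (k + 3) by ring]
    gcongr <;> linarith [(Nat.cast_nonneg j : (0 : ℝ) ≤ j)]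
  rw [he] at h1 h2
  have h5 : (0 : ℝ) ≤ x ^ 3 / ((k + 1) * (k + 2) * (k + 3)) := by positivity
  have h6 := mul_le_mul_of_nonneg_left
    (show ∑' j : ℕ, x ^ (j + k) / ((j + k).factorial : ℝ) ≤ Real.exp x by linarith) h5
  linarith

namespace IsBellCoeff

variable {b : ℕ → ℝ}

theorem mul_ratio_pow_le (hb : IsBellCoeff b) (m j : ℕ) :
    b m * (b (m + j + 1) / b (m + j)) ^ j ≤ b (m + j) := by
  induction j generalizing m with
  | zero => simp
  | succ j ih =>
    have h := ih (m + 1)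
    rw [show m + 1 + j = m + (j + 1) by ring] at h
    refine le_trans ?_ h
    rw [pow_succ', ← mul_assoc]
    have h1 : b (m + (j + 1) + 1) / b (m + (j + 1)) ≤ b (m + 1) / b m :=
      hb.ratio_anti (Nat.le_add_right m (j + 1))
    have h2 : 0 ≤ b (m + (j + 1) + 1) / b (m + (j + 1)) := (div_pos (hb.pos _) (hb.pos _)).le
    refine mul_le_mul_of_nonneg_right ?_ (pow_nonneg h2 _)
    rw [mul_comm]
    exact (le_div_iff₀ (hb.pos m)).1 h1

theorem le_mul_ratio_pow (hb : IsBellCoeff b) (m j : ℕ) :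
    b (m + j) ≤ b m * (b (m + 1) / b m) ^ j := by
  induction j with
  | zero => simp
  | succ j ih =>
    have h1 : b (m + j + 1) / b (m + j) ≤ b (m + 1) / b m :=
      hb.ratio_anti (Nat.le_add_right m j)
    rw [div_le_iff₀ (hb.pos _)] at h1
    rw [← add_assoc, pow_succ']
    calc b (m + j + 1) ≤ b (m + 1) / b m * b (m + j) := h1
      _ ≤ b (m + 1) / b m * (b m * (b (m + 1) / b m) ^ j) := by
        have := (div_pos (hb.pos (m + 1)) (hb.pos m)).le
        gcongr
      _ = _ := by ring

/-- `B_{n+1} / B_n ≤ exp ((n + 1) / (B_{n+1} / B_n))`. -/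
theorem bellRatio_le_exp (hb : IsBellCoeff b) (n : ℕ) :
    ((n : ℝ) + 1) * (b (n + 1) / b n) ≤ Real.exp (b n / b (n + 1)) := by
  have hp := hb.pos
  rw [← mul_div_assoc, hb.succ n, sum_div]
  refine le_trans (sum_le_sum fun j hj => ?_)
    (Real.sum_le_exp_of_nonneg (div_pos (hp _) (hp _)).le (n + 1))
  rw [mem_range] at hj
  obtain ⟨m, rfl⟩ : ∃ m, n = m + j := ⟨n - j, by omega⟩
  have h := hb.mul_ratio_pow_le m j
  rw [Nat.add_sub_cancel, div_div, mul_comm (j.factorial : ℝ), ← div_div]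
  gcongr
  rw [div_pow, div_le_div_iff₀ (hp _) (pow_pos (hp _) _)]
  rw [div_pow, ← mul_div_assoc, div_le_iff₀ (pow_pos (hp _) _)] at h
  linarith

/-- The `j`-th term of the exponential series at `b_n / b_{n+1}` is close to its counterpart in the
recurrence. -/
theorem pow_div_factorial_le (hb : IsBellCoeff b) {n M j : ℕ} (hM : M * M + M ≤ n + 1)
    (hj : j ≤ M) :
    (b n / b (n + 1)) ^ j / (j.factorial : ℝ) ≤ b (n - j) / b n / (j.factorial : ℝ) *
      (1 + 2 * (j * (b (n - j + 1) / b (n - j) / (b (n + 1) / b n) - 1))) := by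
  have hp := hb.pos
  have hjn : j ≤ n := by nlinarith
  set ρ := b (n + 1) / b n with hρ
  set σ := b (n - j + 1) / b (n - j) with hσ
  have hρ0 : 0 < ρ := div_pos (hp _) (hp _)
  have hσ0 : 0 < σ := div_pos (hp _) (hp _)
  set γ := σ / ρ - 1 with hγ
  have hγ0 : 0 ≤ γ := hb.ratio_sub_nonneg n j
  have hjr : (j : ℝ) * j + j ≤ n + 1 := by
    have : j * j + j ≤ n + 1 := by nlinarith
    exact_mod_cast this
  have hjγ : j * γ ≤ 1 := by
    have h := hb.bellRatio_mono (Nat.sub_le n j)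
    simp only at h
    rw [← hρ, ← hσ, Nat.cast_sub hjn] at h
    have h1 : ((n : ℝ) - j + 1) * γ ≤ j := by
      have : σ = (γ + 1) * ρ := by rw [hγ]; field_simp; ring
      rw [this] at h
      have h2 : ((n : ℝ) - j + 1) * (γ + 1) * ρ ≤ (n + 1) * ρ := by linarith
      have := le_of_mul_le_mul_right h2 hρ0
      linarith
    have h3 : (0 : ℝ) < n - j + 1 := by
      have : (j : ℝ) ≤ n := by exact_mod_cast hjn
      linarith
    have h4 : ((n : ℝ) - j + 1) * (j * γ) ≤ (n - j + 1) * 1 := by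
      have : (j : ℝ) * ((n - j + 1) * γ) ≤ j * j := by gcongr
      linarith
    exact le_of_mul_le_mul_left h4 h3
  have h1 : b n ≤ b (n - j) * σ ^ j := by
    have := hb.le_mul_ratio_pow (n - j) j
    rwa [Nat.sub_add_cancel hjn] at this
  have h2 : (b n / b (n + 1)) ^ j ≤ b (n - j) / b n * (1 + γ) ^ j := by
    have e1 : b n / b (n + 1) = ρ⁻¹ := by rw [hρ, inv_div]
    have e2 : 1 + γ = σ * ρ⁻¹ := by rw [hγ, div_eq_mul_inv]; ring
    rw [e1, e2, mul_pow, ← mul_assoc]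
    refine le_mul_of_one_le_left (by positivity) ?_
    rw [div_mul_eq_mul_div, one_le_div (hp n)]
    exact h1
  have h3 : (1 + γ) ^ j ≤ 1 + 2 * (j * γ) := by
    have h4 : (1 + γ) ^ j ≤ Real.exp (j * γ) := by
      rw [Real.exp_nat_mul]
      gcongr
      linarith [Real.add_one_le_exp γ]
    have h5 : 0 ≤ j * γ := by positivity
    have h6 := Real.abs_exp_sub_one_sub_id_le (x := j * γ) (by rwa [abs_of_nonneg h5])
    have h7 := le_abs_self (Real.exp (j * γ) - 1 - j * γ)
    nlinarith
  rw [div_mul_eq_mul_div]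
  gcongr
  exact h2.trans (mul_le_mul_of_nonneg_left h3 (div_pos (hp _) (hp _)).le)

theorem sum_mul_ratio_sub_le (hb : IsBellCoeff b) {n M : ℕ} (hn : 0 < n) (hM : 2 * M ≤ n) :
    ∑ j ∈ range (M + 1), b (n - j) / b n / (j.factorial : ℝ) *
        (j * (b (n - j + 1) / b (n - j) / (b (n + 1) / b n) - 1)) ≤
      4 * (b n / b (n + 1)) / n * ((n + 1) * (b (n + 1) / b n)) := by
  have hp := hb.pos
  have hn' : (0 : ℝ) < n := by exact_mod_cast hn
  set ρ := b (n + 1) / b n with hρ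
  have hρ0 : 0 < ρ := div_pos (hp _) (hp _)
  set γ : ℕ → ℝ := fun j => b (n - j + 1) / b (n - j) / ρ - 1 with hγ
  have hγ0 : ∀ j, 0 ≤ γ j := fun j => hb.ratio_sub_nonneg n j
  set t : ℕ → ℝ := fun j => b (n - j) / b n / (j.factorial : ℝ) with ht
  have ht0 : ∀ j, 0 ≤ t j := fun j => by
    have h1 := hp (n - j)
    have h2 := hp n
    simp only [ht]; positivity
  have e1 : b n / b (n + 1) = ρ⁻¹ := by rw [hρ, inv_div]
  have tsum : ∑ j ∈ range (n + 1), t j = (n + 1) * ρ := by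
    rw [hρ, ← mul_div_assoc, hb.succ n, sum_div]
    exact sum_congr rfl fun j _ => by simp only [ht]; rw [div_right_comm]
  have key : ∑ j ∈ range (n + 1), t j * (((n : ℝ) + 1 - j) * γ j) ≤ (n + 1) * ρ := by
    have h := hb.sum_ratio_sub_le n
    rw [hρ, ← mul_div_assoc, le_div_iff₀ (hp n), sum_mul]
    refine le_trans (le_of_eq (sum_congr rfl fun j _ => ?_)) h
    simp only [ht, hγ, hρ]
    have := (hp n).ne'
    field_simp
  have step : ∀ j ∈ range M, t (j + 1) * (((j + 1 : ℕ) : ℝ) * γ (j + 1)) ≤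
      2 * ρ⁻¹ / n * (t j * (((n : ℝ) + 1 - j) * γ j) + t j) := by
    intro j hj
    rw [mem_range] at hj
    have hjn : j + 1 ≤ n := by omega
    set σ := b (n - (j + 1) + 1) / b (n - (j + 1)) with hσ
    have hσ0 : 0 < σ := div_pos (hp _) (hp _)
    have hσρ : ρ ≤ σ := hb.ratio_anti (Nat.sub_le n (j + 1))
    have e2 : t (j + 1) * ((j + 1 : ℕ) : ℝ) = t j * σ⁻¹ := by
      have e3 : n - (j + 1) + 1 = n - j := by omega
      simp only [ht, hσ, inv_div, e3, Nat.factorial_succ]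
      have := (hp (n - j)).ne'
      push_cast
      field_simp
    have h1 : ((n : ℝ) - j) * γ (j + 1) ≤ (n + 1 - j) * γ j + 1 := by
      have h := hb.bellRatio_mono (show n - (j + 1) ≤ n - j by omega)
      simp only at h
      rw [← hσ, Nat.cast_sub hjn, Nat.cast_sub (by omega : j ≤ n)] at h
      have h2 : σ = (γ (j + 1) + 1) * ρ := by simp only [hγ, hσ]; field_simp; ring
      have h3 : b (n - j + 1) / b (n - j) = (γ j + 1) * ρ := by simp only [hγ]; field_simp; ring
      rw [h2, h3] at h
      push_cast at h
      have h4 : ((n : ℝ) - j) * (γ (j + 1) + 1) * ρ ≤ (n - j + 1) * (γ j + 1) * ρ := by linarith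
      have := le_of_mul_le_mul_right h4 hρ0
      linarith
    have h5 : (n : ℝ) / 2 * γ (j + 1) ≤ (n + 1 - j) * γ j + 1 := by
      refine le_trans (mul_le_mul_of_nonneg_right ?_ (hγ0 _)) h1
      have : (2 : ℝ) * j ≤ n := by exact_mod_cast (by omega : 2 * j ≤ n)
      linarith
    rw [← mul_assoc, e2]
    calc t j * σ⁻¹ * γ (j + 1) ≤ t j * ρ⁻¹ * γ (j + 1) := by
          have := ht0 j
          have := hγ0 (j + 1)
          gcongr
      _ = 2 * ρ⁻¹ / n * (t j * (n / 2 * γ (j + 1))) := by field_simp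
      _ ≤ 2 * ρ⁻¹ / n * (t j * ((n + 1 - j) * γ j + 1)) := by
          have := ht0 j
          gcongr
      _ = _ := by ring
  have hsub : range M ⊆ range (n + 1) := range_subset_range.2 (by omega)
  have nonneg : ∀ j ∈ range (n + 1), 0 ≤ t j * (((n : ℝ) + 1 - j) * γ j) + t j := fun j hj => by
    rw [mem_range] at hj
    have : (j : ℝ) + 1 ≤ n + 1 := by exact_mod_cast hj
    have h := mul_nonneg (ht0 j) (mul_nonneg (by linarith : (0 : ℝ) ≤ n + 1 - j) (hγ0 j))
    linarith [ht0 j]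
  have e3 : ∑ j ∈ range (M + 1), t j * (j * γ j) =
      ∑ j ∈ range M, t (j + 1) * (((j + 1 : ℕ) : ℝ) * γ (j + 1)) := by
    rw [sum_range_succ']; simp
  change ∑ j ∈ range (M + 1), t j * (j * γ j) ≤ _
  rw [e3, e1]
  calc _ ≤ ∑ j ∈ range M, 2 * ρ⁻¹ / n * (t j * (((n : ℝ) + 1 - j) * γ j) + t j) :=
        sum_le_sum step
    _ ≤ 2 * ρ⁻¹ / n * ∑ j ∈ range (n + 1), (t j * (((n : ℝ) + 1 - j) * γ j) + t j) := by
        rw [← mul_sum]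
        refine mul_le_mul_of_nonneg_left ?_ (by positivity)
        exact sum_le_sum_of_subset_of_nonneg hsub fun j hj _ => nonneg j hj
    _ ≤ 2 * ρ⁻¹ / n * ((n + 1) * ρ + (n + 1) * ρ) := by
        rw [sum_add_distrib, tsum]
        gcongr
    _ = _ := by ring

/-- Partial sums of the exponential series at `b_n / b_{n+1}` are bounded in terms of
`B_{n+1} / B_n`. -/
theorem sum_pow_div_factorial_le (hb : IsBellCoeff b) {n M : ℕ} (hn : 0 < n)
    (hM : M * M + M ≤ n + 1) (hM' : 2 * M ≤ n) :
    ∑ j ∈ range (M + 1), (b n / b (n + 1)) ^ j / (j.factorial : ℝ) ≤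
      (1 + 8 * (b n / b (n + 1)) / n) * ((n + 1) * (b (n + 1) / b n)) := by
  have hp := hb.pos
  have h1 : ∑ j ∈ range (M + 1), (b n / b (n + 1)) ^ j / (j.factorial : ℝ) ≤
      ∑ j ∈ range (M + 1), b (n - j) / b n / (j.factorial : ℝ) *
        (1 + 2 * (j * (b (n - j + 1) / b (n - j) / (b (n + 1) / b n) - 1))) :=
    sum_le_sum fun j hj => hb.pow_div_factorial_le hM (by rw [mem_range] at hj; omega)
  have h2 : ∑ j ∈ range (M + 1), b (n - j) / b n / (j.factorial : ℝ) ≤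
      (n + 1) * (b (n + 1) / b n) := by
    rw [← mul_div_assoc, hb.succ n, sum_div]
    refine le_trans (sum_le_sum_of_subset_of_nonneg
      (range_subset_range.2 (by omega : M + 1 ≤ n + 1)) fun j _ _ => ?_)
      (le_of_eq (sum_congr rfl fun j _ => div_right_comm _ _ _))
    have := hp (n - j)
    have := hp n
    positivity
  have h3 := hb.sum_mul_ratio_sub_le hn hM'
  have h4 : ∑ j ∈ range (M + 1), b (n - j) / b n / (j.factorial : ℝ) *
        (1 + 2 * (j * (b (n - j + 1) / b (n - j) / (b (n + 1) / b n) - 1))) =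
      ∑ j ∈ range (M + 1), b (n - j) / b n / (j.factorial : ℝ) +
      2 * ∑ j ∈ range (M + 1), b (n - j) / b n / (j.factorial : ℝ) *
        (j * (b (n - j + 1) / b (n - j) / (b (n + 1) / b n) - 1)) := by
    rw [mul_sum, ← sum_add_distrib]
    exact sum_congr rfl fun j _ => by ring
  rw [h4] at h1
  refine h1.trans ?_
  rw [show (1 + 8 * (b n / b (n + 1)) / n) * ((n + 1) * (b (n + 1) / b n)) =
    (n + 1) * (b (n + 1) / b n) +
      2 * (4 * (b n / b (n + 1)) / n * ((n + 1) * (b (n + 1) / b n))) by ring]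
  linarith

end IsBellCoeff

namespace IsBellCoeff

variable {b : ℕ → ℝ}

theorem exp_le_bellRatio_mul (hb : IsBellCoeff b) {n : ℕ} (hn : 2000 ≤ n) :
    Real.exp (b n / b (n + 1)) ≤
      ((n + 1) * (b (n + 1) / b n)) * Real.exp (80 * (b n / b (n + 1)) / n) := by
  have hp := hb.pos
  obtain ⟨k, hk⟩ : ∃ k, Nat.sqrt n = k + 3 := by
    have : 3 ≤ Nat.sqrt n := Nat.le_sqrt.2 (by omega)
    exact ⟨Nat.sqrt n - 3, by omega⟩
  have hk40 : 40 ≤ k := by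
    have : 43 ≤ Nat.sqrt n := Nat.le_sqrt.2 (by omega)
    omega
  have hs1 : (k + 3) * (k + 3) ≤ n := by rw [← hk]; exact Nat.sqrt_le n
  have hs2 : n < (k + 4) * (k + 4) := by
    have := Nat.lt_succ_sqrt n
    rwa [hk] at this
  have hsum := hb.sum_pow_div_factorial_le (n := n) (M := k + 2) (by omega) (by nlinarith)
    (by nlinarith)
  have htail := exp_le_sum_range_add (div_pos (hp n) (hp (n + 1))).le k
  have hlam : (b n / b (n + 1)) * ((n + 1) * (b (n + 1) / b n)) = n + 1 := by
    have h1 := (hp n).ne'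
    have h2 := (hp (n + 1)).ne'
    field_simp
  have hR1 : 1 ≤ (n + 1) * (b (n + 1) / b n) := by
    have := hb.bellRatio_mono (Nat.zero_le n)
    simpa [hb.zero, hb.one] using this
  have hlam0 : 0 < b n / b (n + 1) := div_pos (hp _) (hp _)
  set R := (n + 1) * (b (n + 1) / b n)
  set l := b n / b (n + 1)
  have hn2 : (2000 : ℝ) ≤ n := by exact_mod_cast hn
  have hn0 : (0 : ℝ) < n := by linarith
  have hln : l ≤ n + 1 := by nlinarith
  have hcube : l ^ 3 / 6 ≤ 10 * R := by
    have h1 : l ^ 3 / 6 ≤ ∑ j ∈ range (k + 2 + 1), l ^ j / (j.factorial : ℝ) := by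
      have := single_le_sum (f := fun j => l ^ j / (j.factorial : ℝ))
        (fun j _ => by positivity) (mem_range.2 (by omega : 3 < k + 2 + 1))
      simpa [Nat.factorial] using this
    have h2 : 8 * l / n ≤ 9 := by
      rw [div_le_iff₀ hn0]; linarith
    nlinarith
  have hl4 : l ^ 4 ≤ 60 * (n + 1) := by nlinarith
  have hx : l / n ≤ 1 / 64 := by
    rw [div_le_iff₀ hn0]
    by_contra! h
    have h1 : ((1 / 64) * (n : ℝ)) ^ 4 < l ^ 4 := by gcongr
    have h2 : (2000 : ℝ) ^ 3 ≤ (n : ℝ) ^ 3 := by gcongr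
    have h3 : (n : ℝ) * 2000 ^ 3 ≤ n * n ^ 3 := by gcongr
    nlinarith
  have hnk : (n : ℝ) + 1 ≤ (k + 4) ^ 2 := by
    have : n + 1 ≤ (k + 4) ^ 2 := by rw [pow_two]; omega
    exact_mod_cast this
  have hk' : (40 : ℝ) ≤ k := by exact_mod_cast hk40
  have hl2 : l ^ 2 ≤ 8 * (k + 4) := by
    refine le_of_sq_le_sq ?_ (by positivity)
    nlinarith
  have hcoef : l ^ 3 / ((k + 1) * (k + 2) * (k + 3)) ≤ 32 * (l / n) := by
    rw [← mul_div_assoc, div_le_div_iff₀ (by positivity) hn0]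
    have h1 : (k + 4 : ℝ) ^ 3 ≤ 4 * ((k + 1) * (k + 2) * (k + 3)) := by nlinarith
    calc l ^ 3 * n = l * (l ^ 2 * n) := by ring
      _ ≤ l * (8 * (k + 4) * (k + 4) ^ 2) := by
        gcongr
        linarith
      _ = 8 * l * (k + 4) ^ 3 := by ring
      _ ≤ 8 * l * (4 * ((k + 1) * (k + 2) * (k + 3))) := by gcongr
      _ = _ := by ring
  have h1 : Real.exp l * (1 - 32 * (l / n)) ≤ (1 + 8 * (l / n)) * R := by
    have := mul_le_mul_of_nonneg_right hcoef (Real.exp_pos l).le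
    rw [mul_div_assoc] at hsum
    linarith
  set x := l / n
  have hx0 : 0 < x := div_pos hlam0 hn0
  have h2 : (1 + 8 * x) ≤ (1 + 80 * x) * (1 - 32 * x) := by nlinarith
  have h3 : Real.exp l * (1 - 32 * x) ≤ R * (1 + 80 * x) * (1 - 32 * x) := by
    refine h1.trans ?_
    nlinarith
  have h4 := le_of_mul_le_mul_right h3 (by linarith)
  refine h4.trans ?_
  rw [mul_div_assoc]
  have := Real.add_one_le_exp (80 * x)
  gcongr
  linarith

/-- `B_{n+1} / B_n = (n + 1) / α + O(1 / α)` where `α * exp α = n + 1`. -/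
theorem bellRatio_bounds (hb : IsBellCoeff b) {n : ℕ} {α : ℝ} (hα : 0 < α)
    (h : α * Real.exp α = n + 1) :
    (n + 1) * (b (n + 1) / b n) ≤ Real.exp α ∧
      α * (Real.exp α - (n + 1) * (b (n + 1) / b n)) ≤ 2001 := by
  have hp := hb.pos
  have hlam : (b n / b (n + 1)) * ((n + 1) * (b (n + 1) / b n)) = n + 1 := by
    have h1 := (hp n).ne'
    have h2 := (hp (n + 1)).ne'
    field_simp
  have hlam0 : 0 < b n / b (n + 1) := div_pos (hp _) (hp _)
  have hR0 : 0 < (n + 1) * (b (n + 1) / b n) :=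
    mul_pos (by positivity) (div_pos (hp _) (hp _))
  have hle := hb.bellRatio_le_exp n
  have hge : 2000 ≤ n → _ := fun hn => hb.exp_le_bellRatio_mul hn
  set R := (n + 1) * (b (n + 1) / b n)
  set l := b n / b (n + 1)
  have hal : α ≤ l := by
    by_contra! hlt
    have h1 : Real.exp l < Real.exp α := Real.exp_lt_exp.2 hlt
    have h2 : l * R < α * Real.exp α := mul_lt_mul hlt (hle.trans h1.le) hR0 hα.le
    linarith
  have hRU : R ≤ Real.exp α := by
    by_contra! hlt
    have : α * Real.exp α < l * R := mul_lt_mul' hal hlt (Real.exp_pos _).le hlam0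
    linarith
  refine ⟨hRU, ?_⟩
  rcases Nat.lt_or_ge n 2000 with hn | hn
  · have : (n : ℝ) < 2000 := by exact_mod_cast hn
    nlinarith
  · have h1 := hge hn
    have hn2 : (2000 : ℝ) ≤ n := by exact_mod_cast hn
    have h2 : Real.exp l ≤ Real.exp (α + 80 * l / n) := by
      rw [Real.exp_add]
      exact h1.trans (by gcongr)
    have h3 := Real.exp_le_exp.1 h2
    have h4 : (l - α) * R ≤ 80 * l / n * R := by
      gcongr
      linarith
    have h5 : 80 * l / n * R = 80 * (n + 1) / n := by
      rw [← hlam]; ring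
    have h6 : 80 * ((n : ℝ) + 1) / n ≤ 2001 := by
      rw [div_le_iff₀ (by linarith)]; linarith
    nlinarith

/-- Asymptotics of the combination of Bell numbers that gives the mean dimension exponent. -/
theorem abs_bellRatio_sub_le (hb : IsBellCoeff b) {n : ℕ} (hn : 2 ≤ n) {α : ℝ} (hα : 0 < α)
    (h : α * Real.exp α = n + 1) :
    |(n + 4) * ((n + 1) * (b (n + 1) / b n)) -
        2 * (((n + 1) * (b (n + 1) / b n)) * ((n + 2) * (b (n + 2) / b (n + 1)))) -
        (α - 2) / α ^ 2 * (n : ℝ) ^ 2| ≤ 20000 * n / α := by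
  obtain ⟨h1, h2⟩ := hb.bellRatio_bounds hα h
  have hp := hb.pos
  have hmono := hb.bellRatio_mono (Nat.le_succ n)
  have hanti := hb.ratio_anti (Nat.le_succ n)
  simp only [Nat.succ_eq_add_one] at hmono hanti
  push_cast at hmono
  have hn2 : (2 : ℝ) ≤ n := by exact_mod_cast hn
  have hα1 : 1 ≤ α := by
    by_contra! hlt
    have h3 : Real.exp α < Real.exp 1 := Real.exp_lt_exp.2 hlt
    have h4 := Real.exp_one_lt_d9
    nlinarith [Real.exp_pos α]
  have hρ0 : 0 < b (n + 1) / b n := div_pos (hp _) (hp _)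
  set ρ := b (n + 1) / b n
  rw [show n + 1 + 1 = n + 2 by ring] at hmono hanti
  set σ := b (n + 2) / b (n + 1)
  have hU : Real.exp α = (n + 1) / α := by rw [eq_div_iff hα.ne', mul_comm, h]
  rw [hU] at h1 h2
  set R := (n + 1) * ρ with hR
  set S := (n + 2) * σ with hS
  have hSR : S ≤ R + ρ := by rw [hS, hR]; nlinarith
  have hRS : R ≤ S := by rw [hS, hR]; linarith
  have hR0 : 0 < R := by positivity
  set β := α⁻¹ with hβ
  have hβ0 : 0 < β := by positivity
  have hβ1 : β ≤ 1 := inv_le_one_of_one_le₀ hα1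
  have hαβ : α * β = 1 := mul_inv_cancel₀ hα.ne'
  rw [div_eq_mul_inv, ← hβ] at h1 h2
  have hlow : ((n : ℝ) + 1) * β - 2001 * β ≤ R := by
    have := mul_le_mul_of_nonneg_right h2 hβ0.le
    have e : α * ((n + 1) * β - R) * β = ((n + 1) * β - R) * (α * β) := by ring
    rw [e, hαβ] at this
    linarith
  have hρβ : ρ ≤ β := by
    refine le_of_mul_le_mul_left (a := (n : ℝ) + 1) ?_ (by positivity)
    exact h1
  have e1 : (α - 2) / α ^ 2 * (n : ℝ) ^ 2 = n ^ 2 * β - 2 * (n ^ 2 * β ^ 2) := by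
    rw [hβ]; field_simp
  have e2 : 20000 * (n : ℝ) / α = 20000 * (n * β) := by rw [hβ]; field_simp
  rw [e1, e2]
  have hnβ : β ≤ n * β := le_mul_of_one_le_left hβ0.le (by linarith)
  have hβ2 : β ^ 2 ≤ β := by nlinarith
  have hprodU : R * S ≤ n ^ 2 * β ^ 2 + 8 * (n * β) := by
    have : R * S ≤ (((n : ℝ) + 1) * β) * ((n + 1) * β + β) := by gcongr <;> linarith
    nlinarith
  have hprodL : n ^ 2 * β ^ 2 - 8008 * (n * β) ≤ R * S := by
    have h3 : R * R ≤ R * S := by gcongr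
    have h4 : (((n : ℝ) + 1) * β) ^ 2 - R ^ 2 ≤ 2 * ((n + 1) * β) * (2001 * β) := by
      have : (((n : ℝ) + 1) * β) ^ 2 - R ^ 2 = ((n + 1) * β - R) * ((n + 1) * β + R) := by ring
      rw [this, mul_comm]
      gcongr <;> linarith
    nlinarith
  rw [abs_le]
  constructor <;> nlinarith

end IsBellCoeff

namespace SetPartition

variable {n : ℕ}

/-- The embedding of subsets of `Fin n` into subsets of `Fin (n + 1)`. -/
abbrev liftBlock (n : ℕ) : Finset (Fin n) ↪ Finset (Fin (n + 1)) :=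
  (Finset.mapEmbedding Fin.castSuccEmb).toEmbedding

theorem castSucc_mem_liftBlock {i : Fin n} {b : Finset (Fin n)} :
    i.castSucc ∈ liftBlock n b ↔ i ∈ b := by
  simp [liftBlock]

theorem last_notMem_liftBlock {b : Finset (Fin n)} : Fin.last n ∉ liftBlock n b := by
  simp [liftBlock, Fin.castSucc_ne_last]

/-- The blocks obtained from `P` by adjoining the point `Fin.last n` to the block `b`, or as a
singleton when `b = ∅`. -/
def adjoinParts (P : SetPartition n) (b : Finset (Fin n)) : Finset (Finset (Fin (n + 1))) :=
  insert (insert (Fin.last n) (liftBlock n b)) ((P.parts.erase b).map (liftBlock n))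

theorem mem_adjoinParts {P : SetPartition n} {b : Finset (Fin n)} {c : Finset (Fin (n + 1))} :
    c ∈ adjoinParts P b ↔ c = insert (Fin.last n) (liftBlock n b) ∨
      ∃ t ∈ P.parts, t ≠ b ∧ liftBlock n t = c := by
  simp only [adjoinParts, mem_insert, mem_map, mem_erase]
  constructor
  · rintro (h | ⟨t, ⟨h1, h2⟩, h3⟩)
    · exact Or.inl h
    · exact Or.inr ⟨t, h2, h1, h3⟩
  · rintro (h | ⟨t, h2, h1, h3⟩)
    · exact Or.inl h
    · exact Or.inr ⟨t, ⟨h1, h2⟩, h3⟩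

theorem insert_last_notMem_map {s : Finset (Finset (Fin n))} {c : Finset (Fin (n + 1))} :
    insert (Fin.last n) c ∉ s.map (liftBlock n) := by
  rw [mem_map]
  rintro ⟨t, -, h⟩
  exact absurd (h ▸ mem_insert_self _ _) last_notMem_liftBlock

/-- The partition of `[n + 1]` obtained from the partition `P` of `[n]` by adjoining the largest
point to the block `b`, or as a singleton when `b = ∅`. -/
def adjoin (P : SetPartition n) (b : {b // b ∈ insert ∅ P.parts}) : SetPartition (n + 1) :=
  Finpartition.ofExistsUnique (adjoinParts P b) (fun _ _ => subset_univ _)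
    (by
      obtain ⟨b, hb⟩ := b
      intro a _
      simp only [mem_adjoinParts]
      induction a using Fin.lastCases with
      | last =>
        refine ⟨_, ⟨Or.inl rfl, mem_insert_self _ _⟩, ?_⟩
        rintro c ⟨rfl | ⟨t, -, -, rfl⟩, hc⟩
        · rfl
        · exact absurd hc last_notMem_liftBlock
      | cast i =>
        obtain ⟨t, ht, hit⟩ := P.exists_mem (mem_univ i)
        by_cases htb : t = b
        · subst htb
          refine ⟨_, ⟨Or.inl rfl, mem_insert_of_mem (castSucc_mem_liftBlock.2 hit)⟩, ?_⟩
          rintro c ⟨rfl | ⟨u, hu, hub, rfl⟩, hc⟩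
          · rfl
          · exact absurd (P.eq_of_mem_parts hu ht (castSucc_mem_liftBlock.1 hc) hit) hub
        · refine ⟨_, ⟨Or.inr ⟨t, ht, htb, rfl⟩, castSucc_mem_liftBlock.2 hit⟩, ?_⟩
          rintro c ⟨rfl | ⟨u, hu, hub, rfl⟩, hc⟩
          · have hib : i ∈ b := by
              rcases mem_insert.1 hc with h | h
              · exact absurd h (Fin.castSucc_ne_last i)
              · exact castSucc_mem_liftBlock.1 h
            rcases mem_insert.1 hb with rfl | hb
            · simp at hib
            · exact absurd (P.eq_of_mem_parts ht hb hit hib) htb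
          · rw [P.eq_of_mem_parts hu ht (castSucc_mem_liftBlock.1 hc) hit])
    (by
      rw [mem_adjoinParts]
      rintro (h | ⟨t, ht, -, h⟩)
      · exact (insert_nonempty _ _).ne_empty h.symm
      · exact P.ne_empty ht (by simpa [liftBlock] using h))

theorem parts_adjoin (P : SetPartition n) (b : {b // b ∈ insert ∅ P.parts}) :
    (adjoin P b).parts = adjoinParts P b := rfl

theorem insert_last_liftBlock_injective :
    Function.Injective fun b => insert (Fin.last n) (liftBlock n b) := by
  intro b c h
  ext i
  have := Finset.ext_iff.1 h i.castSucc
  simpa only [mem_insert, Fin.castSucc_ne_last, false_or, castSucc_mem_liftBlock] using this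

theorem adjoin_bijective :
    Function.Bijective fun x : (P : SetPartition n) × {b // b ∈ insert ∅ P.parts} =>
      adjoin x.1 x.2 := by
  constructor
  · rintro ⟨P, b, hb⟩ ⟨Q, c, hc⟩ h
    have hp : adjoinParts P b = adjoinParts Q c := congrArg Finpartition.parts h
    have hbc : b = c := by
      have h1 : insert (Fin.last n) (liftBlock n b) ∈ adjoinParts Q c := by
        rw [← hp]; exact mem_adjoinParts.2 (Or.inl rfl)
      rcases mem_adjoinParts.1 h1 with h1 | ⟨t, -, -, h1⟩
      · exact insert_last_liftBlock_injective h1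
      · exact absurd (h1 ▸ mem_insert_self _ _) last_notMem_liftBlock
    subst hbc
    have key : ∀ {P Q : SetPartition n}, b ∈ insert ∅ P.parts → b ∈ insert ∅ Q.parts →
        adjoinParts P b = adjoinParts Q b → ∀ t ∈ P.parts, t ∈ Q.parts := by
      intro P Q hb hc hp t ht
      by_cases htb : t = b
      · subst htb
        exact (mem_insert.1 hc).resolve_left (P.ne_empty ht)
      · have h1 : liftBlock n t ∈ adjoinParts Q b := by
          rw [← hp]; exact mem_adjoinParts.2 (Or.inr ⟨t, ht, htb, rfl⟩)
        rcases mem_adjoinParts.1 h1 with h1 | ⟨u, hu, -, h1⟩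
        · exact absurd (h1 ▸ mem_insert_self _ _) last_notMem_liftBlock
        · rwa [← (liftBlock n).injective h1]
    have hPQ : P = Q := by
      ext t
      exact ⟨key hb hc hp t, key hc hb hp.symm t⟩
    subst hPQ
    rfl
  · intro Q
    let r : Finset (Fin (n + 1)) → Finset (Fin n) := fun c => univ.filter fun i => i.castSucc ∈ c
    have mem_r : ∀ {i c}, i ∈ r c ↔ i.castSucc ∈ c := by simp [r]
    have lift_r : ∀ c, Fin.last n ∉ c → liftBlock n (r c) = c := by
      intro c hc
      ext a
      induction a using Fin.lastCases with
      | last => exact iff_of_false last_notMem_liftBlock hc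
      | cast i => rw [castSucc_mem_liftBlock, mem_r]
    have insert_r : ∀ c, Fin.last n ∈ c → insert (Fin.last n) (liftBlock n (r c)) = c := by
      intro c hc
      ext a
      induction a using Fin.lastCases with
      | last => simp [hc]
      | cast i =>
        rw [mem_insert, castSucc_mem_liftBlock, mem_r]
        simp [Fin.castSucc_ne_last]
    let P : SetPartition n := Finpartition.ofExistsUnique ((Q.parts.image r).erase ∅)
      (fun _ _ => subset_univ _)
      (by
        intro i _
        obtain ⟨c, hc, hic⟩ := Q.exists_mem (mem_univ i.castSucc)
        refine ⟨r c, ⟨mem_erase.2 ⟨ne_empty_of_mem (mem_r.2 hic), mem_image_of_mem r hc⟩,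
          mem_r.2 hic⟩, ?_⟩
        rintro t ⟨ht, hit⟩
        obtain ⟨d, hd, rfl⟩ := mem_image.1 (mem_of_mem_erase ht)
        rw [Q.eq_of_mem_parts hd hc (mem_r.1 hit) hic])
      (notMem_erase _ _)
    have hP : P.parts = (Q.parts.image r).erase ∅ := rfl
    obtain ⟨d, hd, hld⟩ := Q.exists_mem (mem_univ (Fin.last n))
    have hb : r d ∈ insert ∅ P.parts := by
      by_cases h : r d = ∅
      · rw [h]; exact mem_insert_self _ _
      · exact mem_insert_of_mem (mem_erase.2 ⟨h, mem_image_of_mem r hd⟩)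
    refine ⟨⟨P, r d, hb⟩, ?_⟩
    have hparts : adjoinParts P (r d) = Q.parts := by
      ext c
      rw [mem_adjoinParts, insert_r d hld]
      constructor
      · rintro (rfl | ⟨t, ht, htd, rfl⟩)
        · exact hd
        · obtain ⟨e, he, rfl⟩ := mem_image.1 (mem_of_mem_erase ht)
          by_cases hle : Fin.last n ∈ e
          · rw [Q.eq_of_mem_parts he hd hle hld] at htd
            exact absurd rfl htd
          · rwa [lift_r e hle]
      · intro hc
        by_cases hlc : Fin.last n ∈ c
        · exact Or.inl (Q.eq_of_mem_parts hc hd hlc hld)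
        · refine Or.inr ⟨r c, mem_erase.2 ⟨?_, mem_image_of_mem r hc⟩, ?_, lift_r c hlc⟩
          · intro h
            have h2 := lift_r c hlc
            rw [h] at h2
            exact Q.ne_empty hc (by rw [← h2]; simp [liftBlock])
          · intro h
            obtain ⟨a, ha⟩ := Q.nonempty_of_mem_parts hc
            have h2 := lift_r c hlc
            have h3 := insert_r d hld
            rw [← h, h2] at h3
            exact hlc (Q.eq_of_mem_parts hc hd ha (h3 ▸ mem_insert_of_mem ha) ▸ hld)
    exact Finpartition.ext hparts

/-- Summation over the partitions of `[n + 1]` by removing the largest point. -/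
theorem sum_succ (H : SetPartition (n + 1) → ℝ) (G₀ : SetPartition n → ℝ)
    (G : SetPartition n → Finset (Fin n) → ℝ)
    (h₀ : ∀ P, H (adjoin P ⟨∅, mem_insert_self _ _⟩) = G₀ P)
    (h : ∀ P b (hb : b ∈ P.parts), H (adjoin P ⟨b, mem_insert_of_mem hb⟩) = G P b) :
    ∑ Q, H Q = ∑ P : SetPartition n, (G₀ P + ∑ b ∈ P.parts, G P b) := by
  rw [← Function.Bijective.sum_comp adjoin_bijective H, Fintype.sum_sigma]
  refine sum_congr rfl fun P _ => ?_
  let K : Finset (Fin n) → ℝ := fun b =>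
    if hb : b ∈ insert ∅ P.parts then H (adjoin P ⟨b, hb⟩) else 0
  have hK : ∀ b (hb : b ∈ insert ∅ P.parts), H (adjoin P ⟨b, hb⟩) = K b := fun b hb => by
    simp only [K, dif_pos hb]
  have hG : ∑ b ∈ P.parts, G P b = ∑ b ∈ P.parts, K b :=
    sum_congr rfl fun b hb => by rw [← h P b hb, hK]
  rw [hG, ← h₀ P, hK, ← sum_insert P.empty_notMem_parts,
    ← sum_coe_sort (insert ∅ P.parts) K]
  exact sum_congr rfl fun b _ => hK b.1 b.2

theorem card_parts_adjoin_empty (P : SetPartition n) :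
    #(adjoin P ⟨∅, mem_insert_self _ _⟩).parts = #P.parts + 1 := by
  rw [parts_adjoin, adjoinParts, card_insert_of_notMem, card_map,
    erase_eq_of_notMem P.empty_notMem_parts]
  exact insert_last_notMem_map

theorem card_parts_adjoin (P : SetPartition n) {b : Finset (Fin n)} (hb : b ∈ P.parts) :
    #(adjoin P ⟨b, mem_insert_of_mem hb⟩).parts = #P.parts := by
  rw [parts_adjoin, adjoinParts, card_insert_of_notMem insert_last_notMem_map, card_map,
    card_erase_add_one hb]

theorem sum_parts_adjoin_empty (P : SetPartition n) (w : Finset (Fin (n + 1)) → ℝ) :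
    ∑ c ∈ (adjoin P ⟨∅, mem_insert_self _ _⟩).parts, w c =
      ∑ t ∈ P.parts, w (liftBlock n t) + w {Fin.last n} := by
  rw [parts_adjoin, adjoinParts, sum_insert insert_last_notMem_map, sum_map,
    erase_eq_of_notMem P.empty_notMem_parts, add_comm]
  simp [liftBlock]

theorem sum_parts_adjoin (P : SetPartition n) {b : Finset (Fin n)} (hb : b ∈ P.parts)
    (w : Finset (Fin (n + 1)) → ℝ) :
    ∑ c ∈ (adjoin P ⟨b, mem_insert_of_mem hb⟩).parts, w c =
      ∑ t ∈ P.parts, w (liftBlock n t) - w (liftBlock n b) +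
        w (insert (Fin.last n) (liftBlock n b)) := by
  rw [parts_adjoin, adjoinParts, sum_insert insert_last_notMem_map, sum_map,
    ← sum_erase_add P.parts _ hb]
  ring

/-- The largest element of a block, or `0` if the block is empty. -/
noncomputable def blockMax (b : Finset (Fin n)) : ℝ :=
  if h : b.Nonempty then ((b.max' h : ℕ) : ℝ) else 0

/-- The smallest element of a block, or `0` if the block is empty. -/
noncomputable def blockMin (b : Finset (Fin n)) : ℝ :=
  if h : b.Nonempty then ((b.min' h : ℕ) : ℝ) else 0

theorem blockMax_liftBlock (b : Finset (Fin n)) : blockMax (liftBlock n b) = blockMax b := by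
  by_cases h : b.Nonempty
  · have h' : (liftBlock n b).Nonempty := h.map
    have : (liftBlock n b).max' h' = (b.max' h).castSucc :=
      (max'_eq_iff _ _ _).2 ⟨castSucc_mem_liftBlock.2 (max'_mem _ _), fun a ha => by
        obtain ⟨i, hi, rfl⟩ := mem_map.1 ha
        exact Fin.castSucc_le_castSucc_iff.2 (le_max' _ _ hi)⟩
    rw [blockMax, dif_pos h', blockMax, dif_pos h, this, Fin.val_castSucc]
  · rw [not_nonempty_iff_eq_empty] at h
    subst h
    simp [blockMax, liftBlock]

theorem blockMin_liftBlock (b : Finset (Fin n)) : blockMin (liftBlock n b) = blockMin b := by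
  by_cases h : b.Nonempty
  · have h' : (liftBlock n b).Nonempty := h.map
    have : (liftBlock n b).min' h' = (b.min' h).castSucc :=
      (min'_eq_iff _ _ _).2 ⟨castSucc_mem_liftBlock.2 (min'_mem _ _), fun a ha => by
        obtain ⟨i, hi, rfl⟩ := mem_map.1 ha
        exact Fin.castSucc_le_castSucc_iff.2 (min'_le _ _ hi)⟩
    rw [blockMin, dif_pos h', blockMin, dif_pos h, this, Fin.val_castSucc]
  · rw [not_nonempty_iff_eq_empty] at h
    subst h
    simp [blockMin, liftBlock]

theorem blockMax_insert_last (b : Finset (Fin (n + 1))) :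
    blockMax (insert (Fin.last n) b) = n := by
  have h : (insert (Fin.last n) b).max' (insert_nonempty _ _) = Fin.last n :=
    (max'_eq_iff _ _ _).2 ⟨mem_insert_self _ _, fun a _ => Fin.le_last a⟩
  rw [blockMax, dif_pos (insert_nonempty _ _), h, Fin.val_last]

theorem blockMin_insert_last {b : Finset (Fin (n + 1))} (hb : b.Nonempty) :
    blockMin (insert (Fin.last n) b) = blockMin b := by
  have h : (insert (Fin.last n) b).min' (insert_nonempty _ _) = b.min' hb :=
    (min'_eq_iff _ _ _).2 ⟨mem_insert_of_mem (min'_mem _ _), fun a ha => by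
      rcases mem_insert.1 ha with rfl | ha
      · exact Fin.le_last _
      · exact min'_le _ _ ha⟩
  rw [blockMin, dif_pos (insert_nonempty _ _), h, blockMin, dif_pos hb]

/-- The sum of the block maxima. -/
noncomputable def sumMax (P : SetPartition n) : ℝ := ∑ b ∈ P.parts, blockMax b

/-- The sum of the block minima. -/
noncomputable def sumMin (P : SetPartition n) : ℝ := ∑ b ∈ P.parts, blockMin b

theorem sumMax_adjoin_empty (P : SetPartition n) :
    sumMax (adjoin P ⟨∅, mem_insert_self _ _⟩) = sumMax P + n := by
  simp only [sumMax, sum_parts_adjoin_empty, blockMax_liftBlock]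
  rw [← insert_empty_eq, blockMax_insert_last]

theorem sumMin_adjoin_empty (P : SetPartition n) :
    sumMin (adjoin P ⟨∅, mem_insert_self _ _⟩) = sumMin P + n := by
  simp only [sumMin, sum_parts_adjoin_empty, blockMin_liftBlock]
  simp [blockMin]

theorem sumMax_adjoin (P : SetPartition n) {b : Finset (Fin n)} (hb : b ∈ P.parts) :
    sumMax (adjoin P ⟨b, mem_insert_of_mem hb⟩) = sumMax P - blockMax b + n := by
  simp only [sumMax, sum_parts_adjoin P hb, blockMax_liftBlock, blockMax_insert_last]

theorem sumMin_adjoin (P : SetPartition n) {b : Finset (Fin n)} (hb : b ∈ P.parts) :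
    sumMin (adjoin P ⟨b, mem_insert_of_mem hb⟩) = sumMin P := by
  have h : (liftBlock n b).Nonempty := (P.nonempty_of_mem_parts hb).map
  simp only [sumMin, sum_parts_adjoin P hb, blockMin_insert_last h, blockMin_liftBlock]
  ring

theorem dimExp_eq (P : SetPartition n) :
    (dimExp P : ℝ) = sumMax P - sumMin P + #P.parts - n := by
  have h : ∀ b : {b // b ∈ P.parts},
      (((b.1.max' (P.nonempty_of_mem_parts b.2)).val : ℝ)
        - ((b.1.min' (P.nonempty_of_mem_parts b.2)).val : ℝ) + 1) =
      blockMax b.1 - blockMin b.1 + 1 := fun b => by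
    rw [blockMax, dif_pos (P.nonempty_of_mem_parts b.2), blockMin,
      dif_pos (P.nonempty_of_mem_parts b.2)]
  rw [dimExp]
  push_cast
  rw [sum_congr rfl fun b _ => h b, sum_attach P.parts fun b => blockMax b - blockMin b + 1,
    sum_add_distrib, sum_sub_distrib, sumMax, sumMin]
  simp

theorem sum_card_succ (n : ℕ) (f : ℕ → ℝ) :
    ∑ Q : SetPartition (n + 1), f #Q.parts =
      ∑ P : SetPartition n, (#P.parts * f #P.parts + f (#P.parts + 1)) := by
  rw [sum_succ _ (fun P => f (#P.parts + 1)) (fun P _ => f #P.parts)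
    (fun P => by rw [card_parts_adjoin_empty]) (fun P b hb => by rw [card_parts_adjoin P hb])]
  refine sum_congr rfl fun P _ => ?_
  rw [sum_const, nsmul_eq_mul, add_comm]

theorem sumMin_zero (P : SetPartition 0) : sumMin P = 0 :=
  sum_eq_zero fun _ hb => ((P.nonempty_of_mem_parts hb).choose).elim0

theorem sumMax_zero (P : SetPartition 0) : sumMax P = 0 :=
  sum_eq_zero fun _ hb => ((P.nonempty_of_mem_parts hb).choose).elim0

theorem card_parts_zero (P : SetPartition 0) : #P.parts = 0 := by
  simp

theorem sum_sumMin_mul (n : ℕ) (f : ℕ → ℝ) :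
    ∑ P : SetPartition n, sumMin P * f #P.parts =
      ∑ P : SetPartition n, ((#P.parts : ℝ) * (#P.parts - 1) * f #P.parts +
        (#P.parts - n) * f (#P.parts + 1)) := by
  induction n generalizing f with
  | zero => simp [sumMin_zero, card_parts_zero]
  | succ n ih =>
    rw [sum_succ _ (fun P => (sumMin P + n) * f (#P.parts + 1))
      (fun P _ => sumMin P * f #P.parts)
      (fun P => by rw [card_parts_adjoin_empty, sumMin_adjoin_empty])
      (fun P b hb => by rw [card_parts_adjoin P hb, sumMin_adjoin P hb])]
    rw [sum_card_succ n fun k => (k : ℝ) * (k - 1) * f k + (k - (n + 1 : ℕ)) * f (k + 1)]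
    have h := ih fun k => k * f k + f (k + 1)
    have e : ∀ P : SetPartition n, (sumMin P + n) * f (#P.parts + 1) +
        ∑ b ∈ P.parts, sumMin P * f #P.parts =
        sumMin P * (#P.parts * f #P.parts + f (#P.parts + 1)) + n * f (#P.parts + 1) := fun P => by
      rw [sum_const, nsmul_eq_mul]
      ring
    rw [sum_congr rfl fun P _ => e P, sum_add_distrib, h, ← sum_add_distrib]
    refine sum_congr rfl fun P _ => ?_
    push_cast
    ring

theorem sum_sumMax_mul (n : ℕ) (f : ℕ → ℝ) :
    ∑ P : SetPartition n, sumMax P * f #P.parts =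
      ∑ P : SetPartition n, (((n : ℝ) * #P.parts - #P.parts ^ 2) * f #P.parts +
        (n - #P.parts) * f (#P.parts + 1)) := by
  induction n generalizing f with
  | zero => simp [sumMax_zero, card_parts_zero]
  | succ n ih =>
    rw [sum_succ _ (fun P => (sumMax P + n) * f (#P.parts + 1))
      (fun P b => (sumMax P - blockMax b + n) * f #P.parts)
      (fun P => by rw [card_parts_adjoin_empty, sumMax_adjoin_empty])
      (fun P b hb => by rw [card_parts_adjoin P hb, sumMax_adjoin P hb])]
    rw [sum_card_succ n fun k => (((n + 1 : ℕ) : ℝ) * k - k ^ 2) * f k +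
      ((n + 1 : ℕ) - k) * f (k + 1)]
    have h := ih fun k => (k - 1) * f k + f (k + 1)
    have e : ∀ P : SetPartition n, (sumMax P + n) * f (#P.parts + 1) +
        ∑ b ∈ P.parts, (sumMax P - blockMax b + n) * f #P.parts =
        sumMax P * ((#P.parts - 1) * f #P.parts + f (#P.parts + 1)) +
          (n * f (#P.parts + 1) + n * #P.parts * f #P.parts) := fun P => by
      rw [← sum_mul, sum_add_distrib, sum_sub_distrib, ← sumMax, sum_const, sum_const,
        nsmul_eq_mul, nsmul_eq_mul]
      ring
    rw [sum_congr rfl fun P _ => e P, sum_add_distrib, h, ← sum_add_distrib]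
    refine sum_congr rfl fun P _ => ?_
    push_cast
    ring

theorem sum_one (n : ℕ) : ∑ _P : SetPartition n, (1 : ℝ) = bell n := by
  simp [bell]

/-- The first moment of the dimension exponent in terms of Bell numbers. -/
theorem sum_dimExp (n : ℕ) :
    ∑ P : SetPartition n, (dimExp P : ℝ) = (n + 4) * bell (n + 1) - 2 * bell (n + 2) := by
  have h1 := sum_sumMax_mul n fun _ => 1
  have h2 := sum_sumMin_mul n fun _ => 1
  have h3 := sum_card_succ n fun _ => 1
  have h4 := sum_card_succ (n + 1) fun _ => 1
  have h5 := sum_card_succ n fun k => k * 1 + 1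
  rw [sum_one] at h3 h4
  simp only [mul_one] at h1 h2 h3 h4 h5
  rw [h5] at h4
  simp only [dimExp_eq]
  rw [h3, h4, sum_sub_distrib, sum_add_distrib, sum_sub_distrib, h1, h2, ← sum_sub_distrib,
    ← sum_add_distrib, ← sum_sub_distrib, mul_sum, mul_sum, ← sum_sub_distrib]
  refine sum_congr rfl fun P _ => ?_
  push_cast
  ring

/-- The operator describing how sums over partitions change when a point is added. -/
def growth (f : ℕ → ℝ) (k : ℕ) : ℝ := k * f k + f (k + 1)

theorem sum_card_eq_iterate (n : ℕ) (f : ℕ → ℝ) :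
    ∑ P : SetPartition n, f #P.parts = (growth^[n]) f 0 := by
  induction n generalizing f with
  | zero =>
    rw [sum_congr rfl fun P _ => by rw [card_parts_zero P]]
    have : Fintype.card (SetPartition 0) = 1 := Fintype.card_eq_one_iff.2
      ⟨⊥, fun P => by
        apply Finpartition.ext
        rw [card_eq_zero.1 (card_parts_zero P), card_eq_zero.1 (card_parts_zero ⊥)]⟩
    simp [this]
  | succ n ih =>
    rw [sum_card_succ, Function.iterate_succ_apply, ← ih]
    rfl

theorem iterate_growth_succ (n : ℕ) : ∀ k,
    (growth^[n]) (fun _ => 1) (k + 1) =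
      ∑ j ∈ range (n + 1), (n.choose j : ℝ) * (growth^[j]) (fun _ => 1) k := by
  induction n with
  | zero => simp
  | succ n ih =>
    intro k
    rw [Function.iterate_succ_apply', growth, ih, ih,
      sum_choose_succ_mul fun j _ => (growth^[j]) (fun _ => 1) k, mul_sum, ← sum_add_distrib, ← sum_add_distrib]
    refine sum_congr rfl fun j _ => ?_
    rw [Function.iterate_succ_apply', growth]
    push_cast
    ring

theorem bell_zero : bell 0 = 1 := by
  have := sum_card_eq_iterate 0 fun _ => 1
  rw [sum_one, Function.iterate_zero_apply] at this
  exact_mod_cast this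

theorem bell_succ (n : ℕ) :
    (bell (n + 1) : ℝ) = ∑ j ∈ range (n + 1), (n.choose j : ℝ) * bell j := by
  have h := sum_card_eq_iterate (n + 1) fun _ => 1
  rw [sum_one, Function.iterate_succ_apply', growth, Nat.cast_zero, zero_mul, zero_add,
    iterate_growth_succ] at h
  rw [h]
  refine sum_congr rfl fun j _ => ?_
  rw [← sum_card_eq_iterate, sum_one]

theorem isBellCoeff : IsBellCoeff fun n => (bell n : ℝ) / n.factorial where
  zero := by simp [bell_zero]
  succ m := by
    rw [bell_succ, Nat.factorial_succ, ← sum_range_reflect, Nat.cast_mul, sum_div, mul_sum]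
    refine sum_congr rfl fun k hk => ?_
    have hk' : k ≤ m := Nat.lt_succ_iff.1 (mem_range.1 hk)
    have e : m + 1 - 1 - k = m - k := by omega
    rw [e, Nat.choose_symm hk', Nat.cast_choose ℝ hk']
    have h1 : (m.factorial : ℝ) ≠ 0 := by positivity
    have h2 : (k.factorial : ℝ) ≠ 0 := by positivity
    have h3 : ((m - k).factorial : ℝ) ≠ 0 := by positivity
    have h4 : ((m : ℝ) + 1) ≠ 0 := by positivity
    push_cast
    field_simp

end SetPartition

/-- Asymptotics of the mean of the dimension exponent: with `α_n` the unique positive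
solution of `u·e^u = n + 1`, one has
`|E(d) - ((α_n - 2)/α_n²)·n²| ≤ C·n/α_n` for all `n ≥ 2`. -/
theorem dimExp_mean_asymptotics :
    ∃ C : ℝ, 0 < C ∧ ∀ n : ℕ, 2 ≤ n → ∀ α : ℝ, 0 < α → α * Real.exp α = n + 1 →
      |(∑ P : SetPartition n, (dimExp P : ℝ)) / (bell n : ℝ)
          - ((α - 2) / α ^ 2) * (n : ℝ) ^ 2| ≤ C * n / α := by
  refine ⟨20000, by norm_num, fun n hn α hα h => ?_⟩
  have hb := SetPartition.isBellCoeff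
  have key := hb.abs_bellRatio_sub_le hn hα h
  have hpos : ∀ m, (0 : ℝ) < bell m := fun m => by
    have hm := hb.pos m
    have hf : (0 : ℝ) < m.factorial := by positivity
    exact (div_pos_iff_of_pos_right hf).1 hm
  have ratio : ∀ m : ℕ, ((m : ℝ) + 1) * ((bell (m + 1) / (m + 1).factorial) /
      (bell m / m.factorial)) = bell (m + 1) / bell m := fun m => by
    have h1 := (hpos m).ne'
    have h2 : (m.factorial : ℝ) ≠ 0 := by positivity
    rw [Nat.factorial_succ]
    push_cast
    field_simp
  have ratio' : ((n : ℝ) + 2) * ((bell (n + 2) / (n + 2).factorial) /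
      (bell (n + 1) / (n + 1).factorial)) = bell (n + 2) / bell (n + 1) := by
    rw [← ratio (n + 1)]
    push_cast
    ring
  have h1 := (hpos n).ne'
  have h2 := (hpos (n + 1)).ne'
  have mean : (∑ P : SetPartition n, (dimExp P : ℝ)) / (bell n : ℝ) =
      (n + 4) * (bell (n + 1) / bell n) -
        2 * ((bell (n + 1) / bell n) * (bell (n + 2) / bell (n + 1))) := by
    rw [SetPartition.sum_dimExp]
    field_simp
  rw [ratio, ratio'] at key
  rwa [mean]
end

section
/- For each integer k ≥ 0 there exist polynomials Q_{k,−k}, Q_{k,−k+1}, …, Q_{k,2k} with rational coefficients such that for all n ≥ k, Σ_{λ ∈ Π(n)} i(λ)^k = Σ_{j=−k}^{2k} Q_{k,j}(n)·B_{n+j}; moreover, for 0 ≤ j ≤ 3k, the degree of Q_{k,2k−j} is at most j. -/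
open Finset

section Umbral

open Polynomial

/-- Multiplication by `1 + X`. -/
noncomputable def mulOneAddX : Module.End ℚ ℚ[X] := LinearMap.mulLeft ℚ (1 + X)

/-- The operator `f ↦ f + f'`. -/
noncomputable def oneAddDeriv : Module.End ℚ ℚ[X] := 1 + derivative

/-- The operator `f ↦ (1 + X) (f + f')`, whose iterates on `1` are shifted Touchard polynomials. -/
noncomputable def touchardOp : Module.End ℚ ℚ[X] := mulOneAddX * oneAddDeriv

theorem mulOneAddX_apply (f : ℚ[X]) : mulOneAddX f = (1 + X) * f := rfl

theorem oneAddDeriv_apply (f : ℚ[X]) : oneAddDeriv f = f + derivative f := rfl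

theorem touchardOp_apply (f : ℚ[X]) : touchardOp f = (1 + X) * (f + derivative f) := rfl

theorem oneAddDeriv_mul_mulOneAddX :
    oneAddDeriv * mulOneAddX = mulOneAddX * oneAddDeriv + 1 := by
  refine LinearMap.ext fun f => ?_
  simp [mulOneAddX, oneAddDeriv]
  ring

theorem oneAddDeriv_mul_mulOneAddX_pow (a : ℕ) :
    oneAddDeriv * mulOneAddX ^ a =
      mulOneAddX ^ a * oneAddDeriv + (a : ℚ) • mulOneAddX ^ (a - 1) := by
  induction a with
  | zero => simp
  | succ a ih =>
    have h : (a : ℚ) • mulOneAddX ^ (a - 1) * mulOneAddX = (a : ℚ) • mulOneAddX ^ a := by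
      rcases a with _ | a
      · simp
      · rw [smul_mul_assoc, ← pow_succ]; rfl
    rw [pow_succ, ← mul_assoc, ih, add_mul, h, mul_assoc, oneAddDeriv_mul_mulOneAddX]
    simp only [Nat.cast_add, Nat.cast_one, add_smul, one_smul, Nat.add_sub_cancel, mul_add, mul_one,
      mul_assoc]
    abel

theorem touchardOp_mul_mulOneAddX_pow (a : ℕ) :
    touchardOp * mulOneAddX ^ a = mulOneAddX ^ a * touchardOp + (a : ℚ) • mulOneAddX ^ a := by
  have h : mulOneAddX * ((a : ℚ) • mulOneAddX ^ (a - 1)) = (a : ℚ) • mulOneAddX ^ a := by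
    rcases a with _ | a
    · simp
    · rw [mul_smul_comm, ← pow_succ']; rfl
  rw [touchardOp, mul_assoc, oneAddDeriv_mul_mulOneAddX_pow, mul_add, h, ← mul_assoc, ← mul_assoc,
    ← pow_succ, ← pow_succ']

theorem touchardOp_mul_oneAddDeriv_pow (b : ℕ) :
    touchardOp * oneAddDeriv ^ b = oneAddDeriv ^ b * touchardOp - (b : ℚ) • oneAddDeriv ^ b := by
  induction b with
  | zero => simp
  | succ b ih =>
    have h : touchardOp * oneAddDeriv = oneAddDeriv * touchardOp - oneAddDeriv := by
      rw [touchardOp, ← mul_assoc, oneAddDeriv_mul_mulOneAddX, add_mul, one_mul]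
      abel
    rw [pow_succ, ← mul_assoc, ih, sub_mul, mul_assoc, h]
    simp only [Nat.cast_add, Nat.cast_one, add_smul, one_smul, mul_sub, smul_mul_assoc, mul_assoc]
    abel

/-- Normally ordered monomials are eigenvectors of the commutator with `touchardOp`. -/
theorem touchardOp_mul_normal (a b : ℕ) :
    touchardOp * (mulOneAddX ^ a * oneAddDeriv ^ b) =
      mulOneAddX ^ a * oneAddDeriv ^ b * touchardOp -
        ((b : ℚ) - a) • (mulOneAddX ^ a * oneAddDeriv ^ b) := by
  rw [← mul_assoc, touchardOp_mul_mulOneAddX_pow, add_mul, mul_assoc,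
    touchardOp_mul_oneAddDeriv_pow, mul_sub, smul_mul_assoc, mul_smul_comm, mul_assoc]
  module

theorem normal_eq_aeval_touchardOp (b : ℕ) :
    mulOneAddX ^ b * oneAddDeriv ^ b = aeval touchardOp (descPochhammer ℚ b) := by
  induction b with
  | zero => simp
  | succ b ih =>
    have h := touchardOp_mul_oneAddDeriv_pow b
    rw [descPochhammer_succ_right, map_mul, ← ih, pow_succ, pow_succ', mul_assoc,
      ← mul_assoc mulOneAddX, ← touchardOp, h]
    simp only [mul_assoc, mul_sub, map_sub, aeval_X, map_natCast, Algebra.smul_def]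
    rw [(Nat.cast_commute b (oneAddDeriv ^ b)).eq]

theorem oneAddDeriv_pow_one (b : ℕ) : (oneAddDeriv ^ b) (1 : ℚ[X]) = 1 := by
  induction b with
  | zero => rfl
  | succ b ih => rw [pow_succ, Module.End.mul_apply, oneAddDeriv_apply]; simpa using ih

/-- `C(n, j) T ^ (n - j) 1`, the Hasse derivative of `T ^ n` applied to `1`. -/
noncomputable def hasseTouchard (j n : ℕ) : ℚ[X] :=
  (n.choose j : ℚ) • (touchardOp ^ (n - j)) 1

theorem hasseTouchard_zero_left (n : ℕ) : hasseTouchard 0 n = (touchardOp ^ n) 1 := by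
  simp [hasseTouchard]

theorem hasseTouchard_zero_succ (n : ℕ) :
    hasseTouchard 0 (n + 1) = touchardOp (hasseTouchard 0 n) := by
  rw [hasseTouchard_zero_left, hasseTouchard_zero_left, pow_succ', Module.End.mul_apply]

theorem hasseTouchard_succ_zero (j : ℕ) : hasseTouchard (j + 1) 0 = 0 := by
  simp [hasseTouchard]

theorem hasseTouchard_succ_succ (j n : ℕ) :
    hasseTouchard (j + 1) (n + 1) = touchardOp (hasseTouchard (j + 1) n) + hasseTouchard j n := by
  rcases lt_or_ge n (j + 1) with h | h
  · simp [hasseTouchard, Nat.choose_succ_succ, Nat.choose_eq_zero_of_lt h]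
  · obtain ⟨m, rfl⟩ := Nat.exists_eq_add_of_le h
    have h1 : j + 1 + m + 1 - (j + 1) = m + 1 := by omega
    have h2 : j + 1 + m - (j + 1) = m := by omega
    have h3 : j + 1 + m - j = m + 1 := by omega
    simp only [hasseTouchard, h1, h2, h3, Nat.choose_succ_succ (j + 1 + m) j, map_smul]
    rw [← Module.End.mul_apply, ← pow_succ', ← add_smul]
    push_cast
    rw [add_comm]

/-- The span of the sequences `n ↦ (1 + X) ^ a (1 + D) ^ b C(n, j) T ^ (n - j) 1` with
`a ≤ A`, `b ≤ B`, `j ≤ J`. -/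
noncomputable def touchardSpan (A B J : ℕ) : Submodule ℚ (ℕ → ℚ[X]) :=
  Submodule.span ℚ {F | ∃ a b j, a ≤ A ∧ b ≤ B ∧ j ≤ J ∧
    F = fun n => (mulOneAddX ^ a * oneAddDeriv ^ b) (hasseTouchard j n)}

theorem mem_touchardSpan {A B J a b j : ℕ} (ha : a ≤ A) (hb : b ≤ B) (hj : j ≤ J) :
    (fun n => (mulOneAddX ^ a * oneAddDeriv ^ b) (hasseTouchard j n)) ∈ touchardSpan A B J :=
  Submodule.subset_span ⟨a, b, j, ha, hb, hj, rfl⟩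

theorem touchardSpan_mono {A B J A' B' J' : ℕ} (hA : A ≤ A') (hB : B ≤ B') (hJ : J ≤ J') :
    touchardSpan A B J ≤ touchardSpan A' B' J' :=
  Submodule.span_mono fun _ ⟨a, b, j, ha, hb, hj, h⟩ =>
    ⟨a, b, j, ha.trans hA, hb.trans hB, hj.trans hJ, h⟩

theorem touchardSpan_map {A B J A' B' J' : ℕ} (W : Module.End ℚ ℚ[X])
    (h : ∀ a b j, a ≤ A → b ≤ B → j ≤ J →
      (fun n => (W * (mulOneAddX ^ a * oneAddDeriv ^ b)) (hasseTouchard j n)) ∈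
        touchardSpan A' B' J') {F : ℕ → ℚ[X]} (hF : F ∈ touchardSpan A B J) :
    (fun n => W (F n)) ∈ touchardSpan A' B' J' := by
  have key : touchardSpan A B J ≤ (touchardSpan A' B' J').comap (W.compLeft ℕ) := by
    refine Submodule.span_le.2 ?_
    rintro _ ⟨a, b, j, ha, hb, hj, rfl⟩
    exact h a b j ha hb hj
  exact key hF

theorem mulOneAddX_mem_touchardSpan {A B J : ℕ} {F : ℕ → ℚ[X]} (hF : F ∈ touchardSpan A B J) :
    (fun n => mulOneAddX (F n)) ∈ touchardSpan (A + 1) B J := by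
  refine touchardSpan_map _ (fun a b j ha hb hj => ?_) hF
  rw [← mul_assoc, ← pow_succ']
  exact mem_touchardSpan (by omega) hb hj

theorem oneAddDeriv_mem_touchardSpan {A B J : ℕ} {F : ℕ → ℚ[X]} (hF : F ∈ touchardSpan A B J) :
    (fun n => oneAddDeriv (F n)) ∈ touchardSpan A (B + 1) J := by
  refine touchardSpan_map _ (fun a b j ha hb hj => ?_) hF
  rw [← mul_assoc, oneAddDeriv_mul_mulOneAddX_pow, add_mul, mul_assoc, ← pow_succ', smul_mul_assoc]
  exact Submodule.add_mem _ (mem_touchardSpan (b := b + 1) ha (by omega) hj)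
    (Submodule.smul_mem _ _ (mem_touchardSpan (a := a - 1) (by omega) (by omega) hj))

theorem X_mul_mem_touchardSpan {A B J : ℕ} {F : ℕ → ℚ[X]} (hF : F ∈ touchardSpan A B J) :
    (fun n => X * F n) ∈ touchardSpan (A + 1) B J := by
  have h := Submodule.sub_mem _ (mulOneAddX_mem_touchardSpan hF)
    (touchardSpan_mono (Nat.le_succ A) le_rfl le_rfl hF)
  convert h using 1
  funext n
  simp only [Pi.sub_apply, mulOneAddX_apply]
  ring

theorem derivative_mem_touchardSpan {A B J : ℕ} {F : ℕ → ℚ[X]} (hF : F ∈ touchardSpan A B J) :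
    (fun n => derivative (F n)) ∈ touchardSpan A (B + 1) J := by
  have h := Submodule.sub_mem _ (oneAddDeriv_mem_touchardSpan hF)
    (touchardSpan_mono le_rfl (Nat.le_succ B) le_rfl hF)
  convert h using 1
  funext n
  simp only [Pi.sub_apply, oneAddDeriv_apply]
  ring

theorem X_pow_mul_mem_touchardSpan {A B J : ℕ} (r : ℕ) {F : ℕ → ℚ[X]}
    (hF : F ∈ touchardSpan A B J) : (fun n => X ^ r * F n) ∈ touchardSpan (A + r) B J := by
  induction r with
  | zero => simpa using hF
  | succ r ih => simpa [pow_succ', mul_assoc, add_assoc] using X_mul_mem_touchardSpan ih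

theorem hasseDeriv_mem_touchardSpan {A B J : ℕ} (r : ℕ) {F : ℕ → ℚ[X]}
    (hF : F ∈ touchardSpan A B J) : (fun n => hasseDeriv r (F n)) ∈ touchardSpan A (B + r) J := by
  have h1 : (fun n => derivative^[r] (F n)) ∈ touchardSpan A (B + r) J := by
    induction r with
    | zero => simpa using hF
    | succ r ih => simpa only [Function.iterate_succ_apply', add_assoc] using
        derivative_mem_touchardSpan ih
  have h2 := Submodule.smul_mem _ ((r.factorial : ℚ)⁻¹) h1
  convert h2 using 1
  funext n
  simp only [Pi.smul_apply, ← factorial_smul_hasseDeriv, LinearMap.smul_apply]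
  rw [← Nat.cast_smul_eq_nsmul ℚ, inv_smul_smul₀ (by positivity)]

theorem exists_touchard_sum_generator {A B J a b : ℕ} (hAB : A ≤ B) (ha : a ≤ A) (hb : b ≤ B)
    (j : ℕ) (hj : j ≤ J) : ∃ F ∈ touchardSpan A B (J + 1), F 0 = 0 ∧ ∀ n, F (n + 1) =
      touchardOp (F n) + (mulOneAddX ^ a * oneAddDeriv ^ b) (hasseTouchard j n) := by
  set w := mulOneAddX ^ a * oneAddDeriv ^ b with hw
  have hT : ∀ f, w (touchardOp f) = touchardOp (w f) + ((b : ℚ) - a) • w f := by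
    intro f
    have h : touchardOp (w f) = w (touchardOp f) - ((b : ℚ) - a) • w f :=
      LinearMap.congr_fun (touchardOp_mul_normal a b) f
    rw [h, sub_add_cancel]
  by_cases hd : (b : ℚ) - a = 0
  · refine ⟨fun n => w (hasseTouchard (j + 1) n), mem_touchardSpan ha hb (by omega), ?_, ?_⟩
    · simp [hasseTouchard_succ_zero]
    · intro n
      simp only [hasseTouchard_succ_succ, map_add, hT, hd, zero_smul, add_zero]
  induction j with
  | zero =>
    have hmem : (fun n => (touchardOp ^ n) (w 1)) ∈ touchardSpan A B (J + 1) := by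
      have h := mem_touchardSpan (J := J + 1) ha (ha.trans hAB) (Nat.zero_le _)
      convert h using 1
      funext n
      have hc : w 1 = (mulOneAddX ^ a * oneAddDeriv ^ a) 1 := by
        simp only [hw, Module.End.mul_apply, oneAddDeriv_pow_one]
      rw [hc, hasseTouchard_zero_left, ← Module.End.mul_apply, ← Module.End.mul_apply,
        normal_eq_aeval_touchardOp]
      congr 1
      have := (Polynomial.commute_X (descPochhammer ℚ a)).map (aeval touchardOp)
      rw [aeval_X] at this
      exact (this.pow_left n).eq
    refine ⟨((b : ℚ) - a)⁻¹ • ((fun n => w (hasseTouchard 0 n)) -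
      fun n => (touchardOp ^ n) (w 1)), Submodule.smul_mem _ _ (Submodule.sub_mem _
        (mem_touchardSpan ha hb (by omega)) hmem), ?_, fun n => ?_⟩
    · simp [hasseTouchard_zero_left]
    · simp only [Pi.smul_apply, Pi.sub_apply, hasseTouchard_zero_succ, hT, pow_succ',
        Module.End.mul_apply, map_smul, map_sub]
      rw [show touchardOp (w (hasseTouchard 0 n)) + ((b : ℚ) - a) • w (hasseTouchard 0 n) -
        touchardOp ((touchardOp ^ n) (w 1)) = (touchardOp (w (hasseTouchard 0 n)) -
        touchardOp ((touchardOp ^ n) (w 1))) + ((b : ℚ) - a) • w (hasseTouchard 0 n) by abel,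
        smul_add, inv_smul_smul₀ hd]
  | succ j ih =>
    obtain ⟨F, hF, hF0, hFs⟩ := ih (by omega)
    refine ⟨((b : ℚ) - a)⁻¹ • ((fun n => w (hasseTouchard (j + 1) n)) - F),
      Submodule.smul_mem _ _ (Submodule.sub_mem _ (mem_touchardSpan ha hb (by omega)) hF),
      ?_, fun n => ?_⟩
    · simp [hasseTouchard_succ_zero, hF0]
    · simp only [Pi.smul_apply, Pi.sub_apply, hasseTouchard_succ_succ, map_add, hT, hFs,
        map_smul, map_sub]
      rw [show touchardOp (w (hasseTouchard (j + 1) n)) +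
        ((b : ℚ) - a) • w (hasseTouchard (j + 1) n) + w (hasseTouchard j n) -
        (touchardOp (F n) + w (hasseTouchard j n)) = (touchardOp (w (hasseTouchard (j + 1) n)) -
        touchardOp (F n)) + ((b : ℚ) - a) • w (hasseTouchard (j + 1) n) by abel,
        smul_add, inv_smul_smul₀ hd]

theorem exists_touchard_sum {A B J : ℕ} (hAB : A ≤ B) {Q : ℕ → ℚ[X]} (hQ : Q ∈ touchardSpan A B J) :
    ∃ F ∈ touchardSpan A B (J + 1), F 0 = 0 ∧ ∀ n, F (n + 1) = touchardOp (F n) + Q n := by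
  induction hQ using Submodule.span_induction with
  | mem Q h =>
    obtain ⟨a, b, j, ha, hb, hj, rfl⟩ := h
    exact exists_touchard_sum_generator hAB ha hb j hj
  | zero => exact ⟨0, Submodule.zero_mem _, rfl, fun n => by simp⟩
  | add Q R _ _ hQ hR =>
    obtain ⟨F, hF, hF0, hFs⟩ := hQ
    obtain ⟨G, hG, hG0, hGs⟩ := hR
    refine ⟨F + G, Submodule.add_mem _ hF hG, by simp [hF0, hG0], fun n => ?_⟩
    simp only [Pi.add_apply, hFs, hGs, map_add]
    abel
  | smul c Q _ hQ =>
    obtain ⟨F, hF, hF0, hFs⟩ := hQ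
    refine ⟨c • F, Submodule.smul_mem _ _ hF, by simp [hF0], fun n => ?_⟩
    simp only [Pi.smul_apply, hFs, map_smul, smul_add]

theorem mem_touchardSpan_of_recurrence {A B J : ℕ} (hAB : A ≤ B) {Q F : ℕ → ℚ[X]}
    (hQ : Q ∈ touchardSpan A B J) (h0 : F 0 = 0) (hs : ∀ n, F (n + 1) = touchardOp (F n) + Q n) :
    F ∈ touchardSpan A B (J + 1) := by
  obtain ⟨G, hG, hG0, hGs⟩ := exists_touchard_sum hAB hQ
  have : F = G := by
    funext n
    induction n with
    | zero => rw [h0, hG0]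
    | succ n ih => rw [hs, hGs, ih]
  rwa [this]

/-- The solution of the `q`-Charlier recurrence, expanded to order `k` in `q - 1`, lies in
`touchardSpan (2 * k) (2 * k) k`. -/
theorem mem_touchardSpan_of_qCharlier {P : ℕ → ℕ → ℚ[X]} (h0 : P 0 0 = 1)
    (h0' : ∀ k, P (k + 1) 0 = 0)
    (hs : ∀ k n, P k (n + 1) = (1 + X) * (P k n +
      ∑ r ∈ Finset.range (k + 1), X ^ r * hasseDeriv (r + 1) (P (k - r) n))) (k : ℕ) :
    P k ∈ touchardSpan (2 * k) (2 * k) k := by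
  induction k using Nat.strong_induction_on with
  | _ k ih =>
    rcases k with _ | k
    · have h : P 0 = fun n => (mulOneAddX ^ 0 * oneAddDeriv ^ 0) (hasseTouchard 0 n) := by
        funext n
        induction n with
        | zero => simp [h0, hasseTouchard]
        | succ n ihn =>
          rw [hs, hasseTouchard_zero_succ]
          simp only [pow_zero, mul_one, Module.End.one_apply] at ihn ⊢
          simp [ihn, touchardOp_apply]
      rw [h]
      exact mem_touchardSpan le_rfl le_rfl le_rfl
    · refine mem_touchardSpan_of_recurrence le_rfl (Q := fun n => (1 + X) *
        ∑ r ∈ Finset.range (k + 1), X ^ (r + 1) * hasseDeriv (r + 2) (P (k - r) n)) ?_ (h0' k) ?_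
      · have h : (fun n => (1 + X) * ∑ r ∈ Finset.range (k + 1),
            X ^ (r + 1) * hasseDeriv (r + 2) (P (k - r) n)) = ∑ r ∈ Finset.range (k + 1),
            fun n => mulOneAddX (X ^ (r + 1) * hasseDeriv (r + 2) (P (k - r) n)) := by
          funext n
          simp only [Finset.sum_apply, mulOneAddX_apply, Finset.mul_sum]
        rw [h]
        refine Submodule.sum_mem _ fun r hr => ?_
        have hr' := Finset.mem_range.1 hr
        exact touchardSpan_mono (by omega) (by omega) (by omega) (mulOneAddX_mem_touchardSpan
          (X_pow_mul_mem_touchardSpan (r + 1)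
            (hasseDeriv_mem_touchardSpan (r + 2) (ih (k - r) (by omega)))))
      · intro n
        rw [hs, Finset.sum_range_succ', touchardOp_apply]
        simp only [Nat.add_sub_add_right, pow_zero, one_mul, zero_add, hasseDeriv_one,
          Nat.sub_zero, Nat.reduceAdd, add_assoc]
        ring

/-- Evaluating a generator of `touchardSpan` at `0`. -/
theorem eval_zero_generator (a b j n : ℕ) :
    eval 0 ((mulOneAddX ^ a * oneAddDeriv ^ b) (hasseTouchard j n)) =
      ∑ i ∈ Finset.range (b + 1), (descPochhammer ℚ b).coeff i *
        ((n.choose j : ℚ) * eval 0 ((touchardOp ^ (n - j + i)) 1)) := by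
  have h1 : ∀ a f, eval 0 ((mulOneAddX ^ a) f) = eval 0 f := by
    intro a f
    induction a with
    | zero => rfl
    | succ a ih => rw [pow_succ', Module.End.mul_apply, mulOneAddX_apply]; simp [ih]
  rw [Module.End.mul_apply, h1, ← h1 b, ← Module.End.mul_apply, normal_eq_aeval_touchardOp,
    aeval_eq_sum_range, descPochhammer_natDegree, LinearMap.sum_apply, eval_finsetSum]
  refine Finset.sum_congr rfl fun i _ => ?_
  rw [hasseTouchard, LinearMap.smul_apply, map_smul, ← Module.End.mul_apply, ← pow_add,
    eval_smul, eval_smul, smul_eq_mul, smul_eq_mul, add_comm]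

/-- Sequences in `touchardSpan (2 * k) (2 * k) k` evaluate to combinations of shifts of the
Touchard numbers with polynomial coefficients of controlled degree. -/
theorem exists_shift_expansion {k : ℕ} {F : ℕ → ℚ[X]} (hF : F ∈ touchardSpan (2 * k) (2 * k) k) :
    ∃ Q : ℤ → ℚ[X],
      (∀ n : ℕ, k ≤ n → eval 0 (F n) = ∑ j ∈ Finset.Icc (-(k : ℤ)) (2 * (k : ℤ)),
        (Q j).eval (n : ℚ) * eval 0 ((touchardOp ^ ((n : ℤ) + j).toNat) 1)) ∧
      (∀ j ∈ Finset.Icc (-(k : ℤ)) (2 * (k : ℤ)),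
        (Q j).natDegree ≤ (2 * (k : ℤ) - j).toNat) := by
  induction hF using Submodule.span_induction with
  | mem F h =>
    obtain ⟨a, b, j, ha, hb, hj, rfl⟩ := h
    let p : ℚ[X] := C ((j.factorial : ℚ)⁻¹) * descPochhammer ℚ j
    have hp : p.natDegree ≤ j := (natDegree_C_mul_le _ _).trans (descPochhammer_natDegree ℚ j).le
    have hpe : ∀ n : ℕ, p.eval (n : ℚ) = n.choose j := by
      intro n
      simp only [p, eval_mul, eval_C, descPochhammer_eval_eq_descFactorial,
        Nat.descFactorial_eq_factorial_mul_choose]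
      push_cast
      rw [inv_mul_cancel_left₀ (by positivity)]
    refine ⟨fun m => ∑ i ∈ Finset.range (b + 1), if m = (i : ℤ) - j then
      C ((descPochhammer ℚ b).coeff i) * p else 0, fun n hn => ?_, fun m hm => ?_⟩
    · rw [eval_zero_generator]
      simp only [eval_finsetSum, Finset.sum_mul]
      rw [Finset.sum_comm]
      refine Finset.sum_congr rfl fun i hi => ?_
      have hi' := Finset.mem_range.1 hi
      rw [Finset.sum_eq_single ((i : ℤ) - j)]
      · rw [if_pos rfl, eval_mul, eval_C, hpe, show ((n : ℤ) + ((i : ℤ) - j)).toNat = n - j + i by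
          omega, mul_assoc]
      · intro m _ hm
        rw [if_neg hm, eval_zero, zero_mul]
      · intro h
        exact absurd (Finset.mem_Icc.2 ⟨by omega, by omega⟩) h
    · refine natDegree_sum_le_of_forall_le _ _ fun i hi => ?_
      have hi' := Finset.mem_range.1 hi
      split_ifs with h
      · exact (natDegree_C_mul_le _ _).trans (hp.trans (by omega))
      · simp
  | zero => exact ⟨0, by simp, by simp⟩
  | add F G _ _ hF hG =>
    obtain ⟨Q, hQ, hQd⟩ := hF
    obtain ⟨R, hR, hRd⟩ := hG
    refine ⟨Q + R, fun n hn => ?_, fun j hj => natDegree_add_le_of_degree_le (hQd j hj) (hRd j hj)⟩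
    simp only [Pi.add_apply, eval_add, hQ n hn, hR n hn, add_mul, Finset.sum_add_distrib]
  | smul c F _ hF =>
    obtain ⟨Q, hQ, hQd⟩ := hF
    refine ⟨c • Q, fun n hn => ?_, fun j hj => (natDegree_smul_le _ _).trans (hQd j hj)⟩
    simp only [Pi.smul_apply, eval_smul, hQ n hn, Finset.smul_sum, smul_mul_assoc]

end Umbral

section ArcSets

/-- The number of crossing pairs of arcs in a set of arcs. -/
def crossings (A : Finset (ℕ × ℕ)) : ℕ :=
  #{q ∈ A ×ˢ A | q.1.1 < q.2.1 ∧ q.2.1 < q.1.2 ∧ q.1.2 < q.2.2}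

/-- The number of arcs of `A` strictly covering `i`. -/
def covering (A : Finset (ℕ × ℕ)) (i : ℕ) : ℕ := #{a ∈ A | a.1 < i ∧ i < a.2}

/-- The points below `n` that are not the left end of an arc of `A`. -/
def terminals (n : ℕ) (A : Finset (ℕ × ℕ)) : Finset ℕ := {i ∈ range n | ∀ b ∈ A, b.1 ≠ i}

/-- The weight of a set of arcs: `q` marks crossings, and `z` marks terminals that are chosen to
remain open. -/
def arcWeight {R : Type*} [CommRing R] (q z : R) (n : ℕ) (A : Finset (ℕ × ℕ)) : R :=
  q ^ crossings A * ∏ i ∈ terminals n A, (1 + z * q ^ covering A i)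

variable {n i : ℕ} {A : Finset (ℕ × ℕ)}

theorem lt_of_mem_terminals (hi : i ∈ terminals n A) : i < n :=
  mem_range.1 (mem_filter.1 hi).1

theorem crossings_insert (hA : ∀ a ∈ A, a.1 < a.2 ∧ a.2 < n) :
    crossings (insert (i, n) A) = crossings A + covering A i := by
  have h : ({q ∈ insert (i, n) A ×ˢ insert (i, n) A |
      q.1.1 < q.2.1 ∧ q.2.1 < q.1.2 ∧ q.1.2 < q.2.2} : Finset ((ℕ × ℕ) × (ℕ × ℕ))) =
      {q ∈ A ×ˢ A | q.1.1 < q.2.1 ∧ q.2.1 < q.1.2 ∧ q.1.2 < q.2.2} ∪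
        {a ∈ A | a.1 < i ∧ i < a.2}.image fun a => (a, (i, n)) := by
    ext ⟨a, b⟩
    simp only [mem_filter, mem_product, mem_insert, mem_union, mem_image, Prod.mk.injEq]
    constructor
    · rintro ⟨⟨rfl | ha, rfl | hb⟩, h1, h2, h3⟩
      · simp at h1
      · have := hA b hb
        simp only at h3
        omega
      · exact Or.inr ⟨a, ⟨ha, h1, h2⟩, rfl, rfl⟩
      · exact Or.inl ⟨⟨ha, hb⟩, h1, h2, h3⟩
    · rintro (⟨⟨ha, hb⟩, h⟩ | ⟨a, ⟨ha, h1, h2⟩, rfl, rfl⟩)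
      · exact ⟨⟨Or.inr ha, Or.inr hb⟩, h⟩
      · exact ⟨⟨Or.inr ha, Or.inl rfl⟩, h1, h2, (hA a ha).2⟩
  have hd : Disjoint
      ({q ∈ A ×ˢ A | q.1.1 < q.2.1 ∧ q.2.1 < q.1.2 ∧ q.1.2 < q.2.2} :
        Finset ((ℕ × ℕ) × (ℕ × ℕ)))
      ({a ∈ A | a.1 < i ∧ i < a.2}.image fun a => (a, (i, n))) := by
    rw [disjoint_left]
    rintro ⟨a, b⟩ h1 h2
    simp only [mem_filter, mem_product, mem_image, Prod.mk.injEq] at h1 h2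
    obtain ⟨_, _, _, rfl⟩ := h2
    exact lt_irrefl _ (hA _ h1.1.2).2
  rw [crossings, h, card_union_of_disjoint hd,
    card_image_of_injective _ fun a b h => (Prod.mk.inj h).1, crossings, covering]

theorem covering_insert {j : ℕ} (hA : ∀ a ∈ A, a.1 < a.2 ∧ a.2 < n) (hj : j < n) :
    covering (insert (i, n) A) j = covering A j + if i < j then 1 else 0 := by
  have hn : (i, n) ∉ A := fun h => lt_irrefl _ (hA _ h).2
  rw [covering, covering, filter_insert]
  simp only [hj, and_true]
  split_ifs with h
  · rw [card_insert_of_notMem fun h' => hn (mem_filter.1 h').1]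
  · rfl

theorem covering_eq_zero (hA : ∀ a ∈ A, a.2 ≤ n) : covering A n = 0 := by
  rw [covering, card_eq_zero, filter_eq_empty_iff]
  intro a ha h
  have := hA a ha
  omega

theorem terminals_succ (hA : ∀ a ∈ A, a.1 < a.2 ∧ a.2 < n) :
    terminals (n + 1) A = insert n (terminals n A) := by
  rw [terminals, range_add_one, filter_insert, if_pos, terminals]
  intro b hb h
  have := hA b hb
  omega

theorem terminals_succ_insert (hA : ∀ a ∈ A, a.1 < a.2 ∧ a.2 < n) (hi : i < n) :
    terminals (n + 1) (insert (i, n) A) = insert n ((terminals n A).erase i) := by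
  ext j
  simp only [terminals, mem_filter, mem_range, mem_insert, mem_erase, forall_eq_or_imp]
  constructor
  · rintro ⟨h1, h2, h3⟩
    by_cases h : j = n
    · exact Or.inl h
    · exact Or.inr ⟨fun h => h2 h.symm, by omega, h3⟩
  · rintro (rfl | ⟨h1, h2, h3⟩)
    · refine ⟨by omega, by omega, fun b hb h => ?_⟩
      have := hA b hb
      omega
    · exact ⟨by omega, fun h => h1 h.symm, h3⟩

theorem notMem_terminals : n ∉ terminals n A := fun h => lt_irrefl _ (lt_of_mem_terminals h)

theorem arcWeight_succ {R : Type*} [CommRing R] (q z : R)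
    (hA : ∀ a ∈ A, a.1 < a.2 ∧ a.2 < n) :
    arcWeight q z (n + 1) A = (1 + z) * arcWeight q z n A := by
  rw [arcWeight, terminals_succ hA, prod_insert notMem_terminals,
    covering_eq_zero fun a ha => (hA a ha).2.le, arcWeight]
  ring

theorem arcWeight_succ_insert {R : Type*} [CommRing R] (q z : R)
    (hA : ∀ a ∈ A, a.1 < a.2 ∧ a.2 < n) (hi : i ∈ terminals n A) :
    arcWeight q z (n + 1) (insert (i, n) A) = (1 + z) * (q ^ crossings A * (q ^ covering A i *
      (∏ j ∈ terminals n A with j < i, (1 + z * q ^ covering A j)) *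
        ∏ j ∈ terminals n A with i < j, (1 + q * z * q ^ covering A j))) := by
  have hin := lt_of_mem_terminals hi
  have hsplit : (terminals n A).erase i =
      {j ∈ terminals n A | j < i} ∪ {j ∈ terminals n A | i < j} := by
    rw [← filter_or, ← filter_ne']
    exact filter_congr fun j _ => ne_iff_lt_or_gt
  have hd : Disjoint {j ∈ terminals n A | j < i} {j ∈ terminals n A | i < j} :=
    disjoint_filter.2 fun j _ h => h.asymm
  rw [arcWeight, crossings_insert hA, terminals_succ_insert hA hin,
    prod_insert fun h => notMem_terminals (mem_of_mem_erase h), covering_eq_zero (A := insert (i, n) A),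
    hsplit,
    prod_union hd]
  · have h1 : ∏ j ∈ terminals n A with j < i, (1 + z * q ^ covering (insert (i, n) A) j) =
        ∏ j ∈ terminals n A with j < i, (1 + z * q ^ covering A j) := by
      refine prod_congr rfl fun j hj => ?_
      obtain ⟨hj, hji⟩ := mem_filter.1 hj
      rw [covering_insert hA (lt_of_mem_terminals hj), if_neg hji.not_gt, add_zero]
    have h2 : ∏ j ∈ terminals n A with i < j, (1 + z * q ^ covering (insert (i, n) A) j) =
        ∏ j ∈ terminals n A with i < j, (1 + q * z * q ^ covering A j) := by
      refine prod_congr rfl fun j hj => ?_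
      obtain ⟨hj, hji⟩ := mem_filter.1 hj
      rw [covering_insert hA (lt_of_mem_terminals hj), if_pos hji, pow_succ]
      ring
    rw [h1, h2]
    ring
  · intro a ha
    rcases mem_insert.1 ha with rfl | ha
    · exact le_rfl
    · exact (hA a ha).2.le

/-- Summing the weights of all one-point extensions is a `q`-derivative. -/
theorem arcWeight_extensions {R : Type*} [CommRing R] (q z : R)
    (hA : ∀ a ∈ A, a.1 < a.2 ∧ a.2 < n) :
    (q - 1) * z * (arcWeight q z (n + 1) A +
      ∑ i ∈ terminals n A, arcWeight q z (n + 1) (insert (i, n) A)) =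
    (1 + z) * ((q - 1) * z * arcWeight q z n A +
      (arcWeight q (q * z) n A - arcWeight q z n A)) := by
  have h := prod_sub_ordered (terminals n A) (fun j => 1 + q * z * q ^ covering A j)
    (fun j => (q - 1) * z * q ^ covering A j)
  have h' : ∀ j, 1 + q * z * q ^ covering A j - (q - 1) * z * q ^ covering A j =
    1 + z * q ^ covering A j := fun j => by ring
  simp only [h'] at h
  have hs : (q - 1) * z * ∑ i ∈ terminals n A, q ^ covering A i *
      (∏ j ∈ terminals n A with j < i, (1 + z * q ^ covering A j)) *
        ∏ j ∈ terminals n A with i < j, (1 + q * z * q ^ covering A j) =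
      ∏ j ∈ terminals n A, (1 + q * z * q ^ covering A j) -
        ∏ j ∈ terminals n A, (1 + z * q ^ covering A j) := by
    rw [h, sub_sub_cancel, mul_sum]
    exact sum_congr rfl fun i _ => by ring
  rw [arcWeight_succ q z hA, sum_congr rfl fun i hi => arcWeight_succ_insert q z hA hi,
    ← mul_sum, ← mul_sum, arcWeight, arcWeight]
  linear_combination (1 + z) * q ^ crossings A * hs

end ArcSets

section Extension

/-- The arc relation of an equivalence relation on `Fin n`. -/
def SetoidArc {n : ℕ} (s : Setoid (Fin n)) (i j : Fin n) : Prop :=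
  i < j ∧ s i j ∧ ∀ k, i < k → k < j → ¬ s i k

open Classical in
/-- The arcs of an equivalence relation on `Fin n`, as pairs of natural numbers. -/
noncomputable def setoidArcs {n : ℕ} (s : Setoid (Fin n)) : Finset (ℕ × ℕ) :=
  ({q : Fin n × Fin n | SetoidArc s q.1 q.2} : Finset (Fin n × Fin n)).image
    fun q => (q.1.val, q.2.val)

theorem mem_setoidArcs {n : ℕ} {s : Setoid (Fin n)} {a b : ℕ} :
    (a, b) ∈ setoidArcs s ↔ ∃ i j : Fin n, SetoidArc s i j ∧ i.val = a ∧ j.val = b := by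
  simp [setoidArcs]

theorem setoidArcs_lt {n : ℕ} (s : Setoid (Fin n)) : ∀ a ∈ setoidArcs s, a.1 < a.2 ∧ a.2 < n := by
  rintro ⟨a, b⟩ hab
  obtain ⟨i, j, hij, rfl, rfl⟩ := mem_setoidArcs.1 hab
  exact ⟨hij.1, j.2⟩

/-- `i` is the largest element of its class. -/
def SetoidLast {n : ℕ} (s : Setoid (Fin n)) (i : Fin n) : Prop := ∀ j, s i j → j ≤ i

theorem setoidLast_iff {n : ℕ} {s : Setoid (Fin n)} {i : Fin n} :
    SetoidLast s i ↔ i.val ∈ terminals n (setoidArcs s) := by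
  classical
  simp only [terminals, mem_filter, mem_range, i.2, true_and]
  constructor
  · rintro h ⟨a, b⟩ hab rfl
    obtain ⟨i', j, hij, h1, rfl⟩ := mem_setoidArcs.1 hab
    obtain rfl := Fin.ext h1
    exact (h j hij.2.1).not_gt hij.1
  · intro h j hij
    by_contra hlt
    have hne : ({k | i < k ∧ s i k} : Finset (Fin n)).Nonempty := ⟨j, by simp [hij, not_le.1 hlt]⟩
    have hm := min'_mem _ hne
    set m := min' _ hne with hmdef
    simp only [mem_filter, mem_univ, true_and] at hm
    refine h (i.val, m.val) (mem_setoidArcs.2 ⟨i, m, ⟨hm.1, hm.2, fun k hk hkm hs => ?_⟩, rfl, rfl⟩)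
      rfl
    exact (min'_le _ k (by simp [hk, hs])).not_gt hkm

/-- Extend an equivalence relation by a new last point, either as a new class or joined to the
class of a given point. -/
def extendSetoid {n : ℕ} (s : Setoid (Fin n)) (o : Option (Fin n)) : Setoid (Fin (n + 1)) :=
  Setoid.ker (Fin.lastCases (motive := fun _ => Option (Quotient s)) (o.map (Quotient.mk s))
    fun j => some (Quotient.mk s j))

variable {n : ℕ} (s : Setoid (Fin n))

theorem extendSetoid_castSucc (o : Option (Fin n)) (i j : Fin n) :
    extendSetoid s o i.castSucc j.castSucc ↔ s i j := by
  rw [extendSetoid, Setoid.ker_def]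
  simp [Quotient.eq]

theorem extendSetoid_castSucc_last_none (i : Fin n) :
    ¬ extendSetoid s none i.castSucc (Fin.last n) := by
  rw [extendSetoid, Setoid.ker_def]
  simp

theorem extendSetoid_castSucc_last_some (i j : Fin n) :
    extendSetoid s (some i) j.castSucc (Fin.last n) ↔ s j i := by
  rw [extendSetoid, Setoid.ker_def]
  simp [Quotient.eq]

theorem extendSetoid_arc_castSucc (o : Option (Fin n)) (i j : Fin n) :
    SetoidArc (extendSetoid s o) i.castSucc j.castSucc ↔ SetoidArc s i j := by
  simp only [SetoidArc, extendSetoid_castSucc, Fin.castSucc_lt_castSucc_iff]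
  refine and_congr_right fun _ => and_congr_right fun _ => ⟨fun h k hk hkj => ?_, fun h k => ?_⟩
  · rw [← extendSetoid_castSucc s o]
    exact h _ (by simpa) (by simpa)
  · induction k using Fin.lastCases with
    | last => exact fun _ h => absurd h (Fin.castSucc_lt_last j).not_gt
    | cast k => simpa [extendSetoid_castSucc] using h k

theorem extendSetoid_arc_last_some {i : Fin n} (hi : SetoidLast s i) (j : Fin n) :
    SetoidArc (extendSetoid s (some i)) j.castSucc (Fin.last n) ↔ j = i := by
  simp only [SetoidArc, extendSetoid_castSucc_last_some]
  constructor
  · rintro ⟨_, h, h'⟩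
    by_contra hne
    have hlt : j < i := lt_of_le_of_ne (hi j (s.symm h)) hne
    exact h' i.castSucc (by simpa) (Fin.castSucc_lt_last i) ((extendSetoid_castSucc _ _ _ _).2 h)
  · rintro rfl
    refine ⟨Fin.castSucc_lt_last j, s.refl j, fun k => ?_⟩
    induction k using Fin.lastCases with
    | last => exact fun _ h => absurd h (lt_irrefl _)
    | cast k =>
      intro hk _ h
      rw [extendSetoid_castSucc] at h
      exact (hi k h).not_gt (by simpa using hk)

theorem setoidArcs_extendSetoid_none : setoidArcs (extendSetoid s none) = setoidArcs s := by
  ext ⟨a, b⟩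
  rw [mem_setoidArcs, mem_setoidArcs]
  constructor
  · rintro ⟨i, j, h, rfl, rfl⟩
    induction i using Fin.lastCases with
    | last => exact absurd h.1 (Fin.le_last j).not_gt
    | cast i =>
      induction j using Fin.lastCases with
      | last => exact absurd h.2.1 (extendSetoid_castSucc_last_none s i)
      | cast j => exact ⟨i, j, (extendSetoid_arc_castSucc s _ i j).1 h, rfl, rfl⟩
  · rintro ⟨i, j, h, rfl, rfl⟩
    exact ⟨i.castSucc, j.castSucc, (extendSetoid_arc_castSucc s _ i j).2 h, rfl, rfl⟩

theorem setoidArcs_extendSetoid_some {i : Fin n} (hi : SetoidLast s i) :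
    setoidArcs (extendSetoid s (some i)) = insert (i.val, n) (setoidArcs s) := by
  ext ⟨a, b⟩
  rw [mem_insert, mem_setoidArcs, mem_setoidArcs]
  constructor
  · rintro ⟨k, j, h, rfl, rfl⟩
    induction k using Fin.lastCases with
    | last => exact absurd h.1 (Fin.le_last j).not_gt
    | cast k =>
      induction j using Fin.lastCases with
      | last =>
        obtain rfl := (extendSetoid_arc_last_some s hi k).1 h
        exact Or.inl rfl
      | cast j => exact Or.inr ⟨k, j, (extendSetoid_arc_castSucc s _ k j).1 h, rfl, rfl⟩
  · rintro (h | ⟨k, j, h, rfl, rfl⟩)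
    · obtain ⟨rfl, rfl⟩ := Prod.mk.inj h
      exact ⟨i.castSucc, Fin.last _, (extendSetoid_arc_last_some s hi i).2 rfl, rfl, rfl⟩
    · exact ⟨k.castSucc, j.castSucc, (extendSetoid_arc_castSucc s _ k j).2 h, rfl, rfl⟩

theorem setoid_fin_succ_ext {s t : Setoid (Fin (n + 1))}
    (h : ∀ i j : Fin n, s i.castSucc j.castSucc ↔ t i.castSucc j.castSucc)
    (h' : ∀ i : Fin n, s i.castSucc (Fin.last n) ↔ t i.castSucc (Fin.last n)) : s = t := by
  refine Setoid.ext fun a b => ?_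
  induction a using Fin.lastCases with
  | last =>
    induction b using Fin.lastCases with
    | last => exact iff_of_true (s.refl _) (t.refl _)
    | cast b => rw [s.comm', t.comm', h']
  | cast a =>
    induction b using Fin.lastCases with
    | last => exact h' a
    | cast b => exact h a b

theorem extendSetoid_bijective (n : ℕ) :
    Function.Bijective fun p : (Σ s : Setoid (Fin n), Option {i : Fin n // SetoidLast s i}) =>
      extendSetoid p.1 (p.2.map Subtype.val) := by
  classical
  constructor
  · rintro ⟨s, o⟩ ⟨t, o'⟩ h
    simp only at h
    have hst : s = t := Setoid.ext fun i j => by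
      rw [← extendSetoid_castSucc s (o.map Subtype.val), h, extendSetoid_castSucc]
    subst hst
    congr 1
    rcases o with _ | ⟨i, hi⟩ <;> rcases o' with _ | ⟨j, hj⟩
    · rfl
    · have := extendSetoid_castSucc_last_none s j
      simp only [Option.map_none, Option.map_some] at h
      rw [h, extendSetoid_castSucc_last_some] at this
      exact absurd (s.refl j) this
    · have := extendSetoid_castSucc_last_none s i
      simp only [Option.map_none, Option.map_some] at h
      rw [← h, extendSetoid_castSucc_last_some] at this
      exact absurd (s.refl i) this
    · have := (extendSetoid_castSucc_last_some s i i).2 (s.refl i)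
      simp only [Option.map_some] at h
      rw [h, extendSetoid_castSucc_last_some] at this
      have hij : i = j := le_antisymm (hj i (s.symm this)) (hi j this)
      subst hij
      rfl
  · intro t
    let s : Setoid (Fin n) := t.comap Fin.castSucc
    have hs : ∀ i j, s i j ↔ t i.castSucc j.castSucc := fun i j => Iff.rfl
    by_cases hne : ({i : Fin n | t i.castSucc (Fin.last n)} : Finset (Fin n)).Nonempty
    · have hm := max'_mem _ hne
      set m := max' _ hne with hmdef
      simp only [mem_filter, mem_univ, true_and] at hm
      have hlast : SetoidLast s m := fun j hj =>
        le_max' _ j (by simpa using t.trans (t.symm ((hs m j).1 hj)) hm)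
      refine ⟨⟨s, some ⟨m, hlast⟩⟩, setoid_fin_succ_ext (fun i j => ?_) fun i => ?_⟩
      · exact extendSetoid_castSucc s _ i j
      · refine (extendSetoid_castSucc_last_some s m i).trans ((hs i m).trans ⟨fun h => ?_, fun h => ?_⟩)
        · exact t.trans h hm
        · exact t.trans h (t.symm hm)
    · refine ⟨⟨s, none⟩, setoid_fin_succ_ext (fun i j => ?_) fun i => ?_⟩
      · exact extendSetoid_castSucc s _ i j
      · refine iff_of_false (extendSetoid_castSucc_last_none s i) fun h => hne ⟨i, by simpa using h⟩

theorem sum_setoid_succ {M : Type*} [AddCommMonoid M] (n : ℕ) [Fintype (Setoid (Fin n))]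
    [Fintype (Setoid (Fin (n + 1)))] (G : Finset (ℕ × ℕ) → M) :
    ∑ t : Setoid (Fin (n + 1)), G (setoidArcs t) = ∑ s : Setoid (Fin n), (G (setoidArcs s) +
      ∑ i ∈ terminals n (setoidArcs s), G (insert (i, n) (setoidArcs s))) := by
  classical
  rw [← Fintype.sum_bijective _ (extendSetoid_bijective n) _ _ fun _ => rfl, Fintype.sum_sigma]
  refine sum_congr rfl fun s _ => ?_
  rw [Fintype.sum_option]
  congr 1
  · simp [setoidArcs_extendSetoid_none]
  · refine sum_bij (fun i _ => i.1.val) (fun i _ => setoidLast_iff.1 i.2)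
      (fun i _ j _ h => Subtype.ext (Fin.ext h)) (fun i hi => ?_) fun i _ => ?_
    · exact ⟨⟨⟨i, lt_of_mem_terminals hi⟩, setoidLast_iff.2 hi⟩, mem_univ _, rfl⟩
    · simp [setoidArcs_extendSetoid_some s i.2]

/-- Being in the same block, as an equivalence relation. -/
def blockSetoid {n : ℕ} (P : SetPartition n) : Setoid (Fin n) where
  r := SameBlock P
  iseqv :=
    { refl := fun i => by
        obtain ⟨b, hb, hi⟩ := P.exists_mem (mem_univ i)
        exact ⟨b, hb, hi, hi⟩
      symm := fun ⟨b, hb, hi, hj⟩ => ⟨b, hb, hj, hi⟩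
      trans := fun ⟨b, hb, hi, hj⟩ ⟨c, hc, hj', hk⟩ => by
        obtain rfl := P.eq_of_mem_parts hb hc hj hj'
        exact ⟨b, hb, hi, hk⟩ }

theorem mem_part_iff_sameBlock {n : ℕ} (P : SetPartition n) {i j : Fin n} :
    i ∈ P.part j ↔ SameBlock P i j := P.mem_part_iff_exists

theorem blockSetoid_bijective (n : ℕ) : Function.Bijective (blockSetoid (n := n)) := by
  classical
  constructor
  · have key : ∀ P Q : SetPartition n, blockSetoid P = blockSetoid Q → P.parts ⊆ Q.parts := by
      intro P Q h b hb
      obtain ⟨i, hi⟩ := P.nonempty_of_mem_parts hb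
      have : b = Q.part i := by
        rw [← P.part_eq_of_mem hb hi]
        ext j
        rw [mem_part_iff_sameBlock, mem_part_iff_sameBlock]
        exact Setoid.ext_iff.1 h j i
      rw [this]
      exact Q.part_mem.2 (mem_univ i)
    exact fun P Q h => Finpartition.ext ((key P Q h).antisymm (key Q P h.symm))
  · intro s
    refine ⟨Finpartition.ofSetoid s, Setoid.ext fun i j => ?_⟩
    exact (mem_part_iff_sameBlock _).symm.trans
      (Finpartition.mem_part_ofSetoid_iff_rel.trans s.comm')

theorem inter_eq_crossings {n : ℕ} (P : SetPartition n) :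
    inter P = crossings (setoidArcs (blockSetoid P)) := by
  classical
  let f : (Fin n × Fin n) × (Fin n × Fin n) → (ℕ × ℕ) × (ℕ × ℕ) :=
    fun q => ((q.1.1.val, q.1.2.val), (q.2.1.val, q.2.2.val))
  have hf : Function.Injective f := by
    rintro ⟨⟨a, b⟩, c, d⟩ ⟨⟨a', b'⟩, c', d'⟩ h
    simpa [f, Fin.ext_iff] using h
  rw [inter, ← Set.ncard_image_of_injective _ hf, crossings, ← Set.ncard_coe_finset]
  congr 1
  ext ⟨⟨a, b⟩, c, d⟩
  simp only [Set.mem_image, Set.mem_ofPred_eq, coe_filter, mem_product, mem_setoidArcs]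
  constructor
  · rintro ⟨⟨⟨a, b⟩, c, d⟩, ⟨h1, h2, h⟩, he⟩
    obtain ⟨⟨rfl, rfl⟩, rfl, rfl⟩ : (a.val = _ ∧ b.val = _) ∧ c.val = _ ∧ d.val = _ := by
      simpa [f] using he
    exact ⟨⟨⟨a, b, h1, rfl, rfl⟩, c, d, h2, rfl, rfl⟩, h⟩
  · rintro ⟨⟨⟨a, b, h1, rfl, rfl⟩, c, d, h2, rfl, rfl⟩, h⟩
    exact ⟨((a, b), (c, d)), ⟨h1, h2, h⟩, rfl⟩

theorem sum_setPartition_succ {M : Type*} [AddCommMonoid M] (n : ℕ)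
    (G : Finset (ℕ × ℕ) → M) :
    ∑ P : SetPartition (n + 1), G (setoidArcs (blockSetoid P)) =
      ∑ P : SetPartition n, (G (setoidArcs (blockSetoid P)) +
        ∑ i ∈ terminals n (setoidArcs (blockSetoid P)),
          G (insert (i, n) (setoidArcs (blockSetoid P)))) := by
  let _ : ∀ m, Fintype (Setoid (Fin m)) := fun m =>
    Fintype.ofEquiv _ (Equiv.ofBijective _ (blockSetoid_bijective m))
  rw [Fintype.sum_bijective _ (blockSetoid_bijective (n + 1)) _ (fun t => G (setoidArcs t))
    fun _ => rfl, sum_setoid_succ]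
  exact (Fintype.sum_bijective _ (blockSetoid_bijective n) _ _ fun _ => rfl).symm

end Extension

section GeneratingFunction

open Polynomial

/-- The substitution `z ↦ (1 + u) z`, from polynomials in `z` to polynomials in `z` and `u`. -/
noncomputable def dilate : ℚ[X] →+* ℚ[X][X] := eval₂RingHom (C.comp C) ((1 + X) * C X)

/-- The substitution `z ↦ (1 + u) z` on polynomials in `z` and `u`. -/
noncomputable def dilateInner : ℚ[X][X] →+* ℚ[X][X] := eval₂RingHom dilate X

theorem coeff_dilate (p : ℚ[X]) (r : ℕ) : (dilate p).coeff r = X ^ r * hasseDeriv r p := by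
  induction p using Polynomial.induction_on' with
  | add p q hp hq => simp only [map_add, coeff_add, hp, hq, mul_add]
  | monomial l c =>
    have h : dilate (monomial l c) = C (C c * X ^ l) * (1 + X) ^ l := by
      simp only [dilate, coe_eval₂RingHom, eval₂_monomial, RingHom.comp_apply, mul_pow, map_mul,
        map_pow]
      ring
    rw [h, coeff_C_mul, coeff_one_add_X_pow, hasseDeriv_monomial]
    rcases lt_or_ge l r with hlr | hlr
    · simp [Nat.choose_eq_zero_of_lt hlr]
    · obtain ⟨m, rfl⟩ := Nat.exists_eq_add_of_le hlr
      rw [Nat.add_sub_cancel_left, ← C_mul_X_pow_eq_monomial, map_mul, map_natCast, pow_add]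
      ring

theorem coeff_dilateInner (F : ℚ[X][X]) (k : ℕ) : (dilateInner F).coeff k =
    ∑ r ∈ Finset.range (k + 1), X ^ r * hasseDeriv r (F.coeff (k - r)) := by
  induction F using Polynomial.induction_on' with
  | add p q hp hq => simp only [map_add, coeff_add, hp, hq, mul_add, Finset.sum_add_distrib]
  | monomial m p =>
    have h : dilateInner (monomial m p) = dilate p * X ^ m := by
      simp [dilateInner, eval₂_monomial]
    rw [h, coeff_mul_X_pow']
    split_ifs with hm
    · rw [Finset.sum_eq_single (k - m), coeff_dilate, Nat.sub_sub_self hm, coeff_monomial_same]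
      · intro r hr hne
        have hr' := Finset.mem_range.1 hr
        rw [coeff_monomial, if_neg (by omega), map_zero, mul_zero]
      · intro h
        exact absurd (Finset.mem_range.2 (by omega)) h
    · refine (Finset.sum_eq_zero fun r _ => ?_).symm
      rw [coeff_monomial, if_neg (by omega), map_zero, mul_zero]

theorem map_arcWeight {R S : Type*} [CommRing R] [CommRing S] (f : R →+* S) (q z : R) (n : ℕ)
    (A : Finset (ℕ × ℕ)) : f (arcWeight q z n A) = arcWeight (f q) (f z) n A := by
  simp [arcWeight, map_prod]

/-- The generating polynomial of set partitions of `[n]` by `arcWeight`, where the outer variable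
is `q - 1`. -/
noncomputable def crossingPoly (n : ℕ) : ℚ[X][X] :=
  ∑ P : SetPartition n, arcWeight (1 + X) (C X) n (setoidArcs (blockSetoid P))

theorem crossingPoly_zero : crossingPoly 0 = 1 := by
  have hs : Subsingleton (SetPartition 0) :=
    ⟨fun P Q => (blockSetoid_bijective 0).1 (Setoid.ext fun i => i.elim0)⟩
  rw [crossingPoly, Fintype.sum_subsingleton _ (⊥ : SetPartition 0)]
  have h : setoidArcs (blockSetoid (⊥ : SetPartition 0)) = ∅ := by
    refine Finset.eq_empty_of_forall_notMem fun a ha => ?_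
    exact absurd (setoidArcs_lt _ a ha).2 (Nat.not_lt_zero _)
  rw [h]
  simp [arcWeight, crossings, terminals]

theorem crossingPoly_succ (n : ℕ) : X * (C X * crossingPoly (n + 1)) = C (1 + X) *
    (X * (C X * crossingPoly n) + (dilateInner (crossingPoly n) - crossingPoly n)) := by
  have hσ : ∀ A, dilateInner (arcWeight (1 + X) (C X) n A) =
      arcWeight (1 + X) ((1 + X) * C X) n A := by
    intro A
    rw [map_arcWeight]
    simp [dilateInner, dilate]
  simp only [crossingPoly]
  rw [sum_setPartition_succ n (arcWeight (1 + X : ℚ[X][X]) (C X) (n + 1)), map_sum]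
  simp only [hσ, Finset.mul_sum, ← Finset.sum_sub_distrib, ← Finset.sum_add_distrib]
  refine Finset.sum_congr rfl fun P _ => ?_
  have h := arcWeight_extensions (1 + X : ℚ[X][X]) (C X)
    (setoidArcs_lt (blockSetoid P))
  rw [add_sub_cancel_left] at h
  rw [map_add, map_one]
  linear_combination h

theorem coeff_crossingPoly_succ (k n : ℕ) : (crossingPoly (n + 1)).coeff k =
    (1 + X) * ((crossingPoly n).coeff k + ∑ r ∈ Finset.range (k + 1),
      X ^ r * hasseDeriv (r + 1) ((crossingPoly n).coeff (k - r))) := by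
  have h := congrArg (fun F => F.coeff (k + 1)) (crossingPoly_succ n)
  simp only [coeff_X_mul, coeff_C_mul, coeff_add, coeff_sub, coeff_dilateInner] at h
  rw [Finset.sum_range_succ'] at h
  simp only [pow_zero, one_mul, Nat.sub_zero, hasseDeriv_zero', Nat.add_sub_add_right,
    add_sub_cancel_right, pow_succ', mul_assoc] at h
  rw [← Finset.mul_sum, ← mul_add, mul_left_comm] at h
  exact mul_left_cancel₀ X_ne_zero h

theorem eval_coeff_crossingPoly (k n : ℕ) : eval 0 ((crossingPoly n).coeff k) =
    ∑ P : SetPartition n, ((inter P).choose k : ℚ) := by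
  rw [← coe_evalRingHom, ← coeff_map, crossingPoly, ← coe_mapRingHom, map_sum, finsetSum_coeff]
  refine Finset.sum_congr rfl fun P _ => ?_
  rw [map_arcWeight, inter_eq_crossings, ← coeff_one_add_X_pow]
  simp [arcWeight]

theorem crossingPoly_mem_touchardSpan (k : ℕ) :
    (fun n => (crossingPoly n).coeff k) ∈ touchardSpan (2 * k) (2 * k) k :=
  mem_touchardSpan_of_qCharlier (P := fun k n => (crossingPoly n).coeff k)
    (by simp [crossingPoly_zero]) (fun k => by simp [crossingPoly_zero, coeff_one])
    coeff_crossingPoly_succ k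

theorem bell_eq_eval_touchardOp (n : ℕ) : (bell n : ℚ) = eval 0 ((touchardOp ^ n) 1) := by
  have h : (touchardOp ^ n) 1 = (crossingPoly n).coeff 0 := by
    induction n with
    | zero => simp [crossingPoly_zero]
    | succ n ih =>
      rw [pow_succ', Module.End.mul_apply, ih, coeff_crossingPoly_succ, touchardOp_apply]
      simp
  rw [h, eval_coeff_crossingPoly]
  simp [bell]

theorem exists_pow_eq_sum_choose (k : ℕ) : ∃ c : ℕ → ℚ, ∀ x : ℕ,
    (x : ℚ) ^ k = ∑ r ∈ Finset.range (k + 1), c r * (x.choose r : ℚ) := by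
  induction k with
  | zero => exact ⟨1, by simp⟩
  | succ k ih =>
    obtain ⟨c, hc⟩ := ih
    refine ⟨fun r => (if r < k + 1 then c r * r else 0) + c (r - 1) * r, fun x => ?_⟩
    have hx : ∀ r : ℕ, (x : ℚ) * x.choose r = r * x.choose r + (r + 1) * x.choose (r + 1) := by
      intro r
      have h : (x + 1) * x.choose r = (x + 1).choose (r + 1) * (r + 1) :=
        Nat.add_one_mul_choose_eq x r
      rw [Nat.choose_succ_succ] at h
      have h' := congrArg (Nat.cast (R := ℚ)) h
      push_cast at h'
      linear_combination h'
    simp only [add_mul, Finset.sum_add_distrib]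
    rw [Finset.sum_range_succ, if_neg (lt_irrefl _), Finset.sum_range_succ' (fun r =>
      c (r - 1) * r * (x.choose r : ℚ)), pow_succ', hc, Finset.mul_sum]
    simp only [zero_mul, add_zero, Nat.cast_zero, mul_zero, Nat.add_sub_cancel,
      ← Finset.sum_add_distrib]
    refine Finset.sum_congr rfl fun r hr => ?_
    rw [if_pos (Finset.mem_range.1 hr)]
    push_cast
    linear_combination c r * hx r

end GeneratingFunction

/-- For each `k` there are polynomials `Q_{k,-k}, …, Q_{k,2k} ∈ ℚ[x]` with
`Σ_{λ ∈ Π(n)} i(λ)^k = Σ_{j=-k}^{2k} Q_{k,j}(n) B_{n+j}` for all `n ≥ k`, and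
`deg Q_{k,2k-j} ≤ j` for `0 ≤ j ≤ 3k` (i.e. `deg Q_{k,m} ≤ 2k - m`). -/
theorem inter_moments_shiftedBell (k : ℕ) :
    ∃ Q : ℤ → Polynomial ℚ,
      (∀ n : ℕ, k ≤ n →
        ∑ lam : SetPartition n, (inter lam : ℚ) ^ k =
          ∑ j ∈ Finset.Icc (-(k : ℤ)) (2 * (k : ℤ)),
            (Q j).eval (n : ℚ) * (bell ((n : ℤ) + j).toNat : ℚ)) ∧
      (∀ j ∈ Finset.Icc (-(k : ℤ)) (2 * (k : ℤ)),
        (Q j).natDegree ≤ (2 * (k : ℤ) - j).toNat) := by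
  obtain ⟨c, hc⟩ := exists_pow_eq_sum_choose k
  obtain ⟨Q, hQ, hd⟩ := exists_shift_expansion (k := k)
    (F := ∑ r ∈ Finset.range (k + 1), c r • fun n => (crossingPoly n).coeff r)
    (Submodule.sum_mem _ fun r hr => Submodule.smul_mem _ _ (by
      have hr' := Finset.mem_range.1 hr
      exact touchardSpan_mono (by omega) (by omega) (by omega) (crossingPoly_mem_touchardSpan r)))
  refine ⟨Q, fun n hn => ?_, hd⟩
  simp only [bell_eq_eval_touchardOp]
  rw [← hQ n hn]
  simp only [Finset.sum_apply, Pi.smul_apply, Polynomial.eval_finsetSum, Polynomial.eval_smul,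
    eval_coeff_crossingPoly, hc, smul_eq_mul, Finset.mul_sum]
  exact Finset.sum_comm
end

section
/- For every n ≥ 1, the sum over all set partitions λ of [n] of the intertwining exponent i(λ) equals (1/4)·((2n+1)B_n + (2n+9)B_{n+1} − 5B_{n+2}). -/
open Finset

open Polynomial

namespace SetPartition

variable {n : ℕ}

section SameBlock

theorem sameBlock_iff_mem_part (P : SetPartition n) (i j : Fin n) :
    SameBlock P i j ↔ i ∈ P.part j :=
  P.mem_part_iff_exists.symm

theorem sameBlock_equivalence (P : SetPartition n) : Equivalence (SameBlock P) where
  refl i := by simp [sameBlock_iff_mem_part]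
  symm := fun ⟨b, hb, hi, hj⟩ ↦ ⟨b, hb, hj, hi⟩
  trans := by
    rintro i j k ⟨b, hb, hi, hj⟩ ⟨b', hb', hj', hk⟩
    obtain rfl := P.eq_of_mem_parts hb hb' hj hj'
    exact ⟨b, hb, hi, hk⟩

theorem ext_sameBlock {P Q : SetPartition n} (h : ∀ i j, SameBlock P i j ↔ SameBlock Q i j) :
    P = Q := by
  have hpart : ∀ i, P.part i = Q.part i := fun i ↦ by
    ext j
    rw [← sameBlock_iff_mem_part, ← sameBlock_iff_mem_part, h]
  have key : ∀ {P Q : SetPartition n}, (∀ i, P.part i = Q.part i) → P.parts ⊆ Q.parts := by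
    intro P Q hPQ b hb
    obtain ⟨i, hi⟩ := P.nonempty_of_mem_parts hb
    rw [← P.part_eq_of_mem hb hi, hPQ]
    exact Q.part_mem.2 (mem_univ i)
  exact Finpartition.ext (Subset.antisymm (key hpart) (key fun i ↦ (hpart i).symm))

theorem exists_sameBlock_iff {r : Fin n → Fin n → Prop} (hr : Equivalence r) :
    ∃ P : SetPartition n, ∀ i j, SameBlock P i j ↔ r i j := by
  classical
  refine ⟨Finpartition.ofSetoid ⟨r, hr⟩, fun i j ↦ ?_⟩
  rw [sameBlock_iff_mem_part, Finpartition.mem_part_ofSetoid_iff_rel]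
  exact ⟨hr.symm, hr.symm⟩

end SameBlock

section Insert

/-- The relation on `Option (Fin n)` that extends `SameBlock P` by the singleton class `{none}`. -/
def OptionRel (P : SetPartition n) : Option (Fin n) → Option (Fin n) → Prop
  | some i, some j => SameBlock P i j
  | none, none => True
  | _, _ => False

theorem optionRel_equivalence (P : SetPartition n) : Equivalence (OptionRel P) where
  refl
    | none => trivial
    | some i => (sameBlock_equivalence P).refl i
  symm {x y} h := by
    cases x <;> cases y <;> simp only [OptionRel] at h ⊢
    exact (sameBlock_equivalence P).symm h
  trans {x y z} h h' := by
    cases x <;> cases y <;> cases z <;> simp only [OptionRel] at h h' ⊢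
    exact (sameBlock_equivalence P).trans h h'

theorem exists_insertLast (P : SetPartition n) (o : Option (Fin n)) :
    ∃ Q : SetPartition (n + 1), ∀ x y, SameBlock Q x y ↔
      OptionRel P (Fin.lastCases o some x) (Fin.lastCases o some y) :=
  exists_sameBlock_iff ((optionRel_equivalence P).comap _)

/-- Insert a new largest element into a set partition: as a singleton block if `o = none`, and into
the block of `c` if `o = some c`. -/
noncomputable def insertLast (P : SetPartition n) (o : Option (Fin n)) : SetPartition (n + 1) :=
  (exists_insertLast P o).choose

theorem sameBlock_insertLast (P : SetPartition n) (o : Option (Fin n)) (x y : Fin (n + 1)) :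
    SameBlock (insertLast P o) x y ↔
      OptionRel P (Fin.lastCases o some x) (Fin.lastCases o some y) :=
  (exists_insertLast P o).choose_spec x y

@[simp]
theorem sameBlock_insertLast_castSucc (P : SetPartition n) (o : Option (Fin n)) (i j : Fin n) :
    SameBlock (insertLast P o) i.castSucc j.castSucc ↔ SameBlock P i j := by
  simp [sameBlock_insertLast, OptionRel]

@[simp]
theorem sameBlock_insertLast_castSucc_last (P : SetPartition n) (o : Option (Fin n)) (i : Fin n) :
    SameBlock (insertLast P o) i.castSucc (Fin.last n) ↔ ∃ c, o = some c ∧ SameBlock P i c := by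
  cases o <;> simp [sameBlock_insertLast, OptionRel]

theorem isArc_insertLast_castSucc (P : SetPartition n) (o : Option (Fin n)) (i j : Fin n) :
    IsArc (insertLast P o) i.castSucc j.castSucc ↔ IsArc P i j := by
  simp [IsArc, Fin.forall_fin_succ', (Fin.le_last _).not_gt]

theorem isArc_insertLast_last {P : SetPartition n} {o : Option (Fin n)}
    (ho : ∀ c, o = some c → IsLast P c) (i : Fin n) :
    IsArc (insertLast P o) i.castSucc (Fin.last n) ↔ o = some i := by
  simp only [IsArc, Fin.castSucc_lt_last, true_and, sameBlock_insertLast_castSucc_last,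
    Fin.forall_fin_succ', Fin.castSucc_lt_castSucc_iff, sameBlock_insertLast_castSucc,
    forall_true_left, lt_irrefl, false_imp_iff, implies_true, and_true]
  constructor
  · rintro ⟨⟨c, rfl, hc⟩, h⟩
    have hle := ho c rfl i ((sameBlock_equivalence P).symm hc)
    rcases hle.lt_or_eq with hlt | rfl
    · exact absurd hc (h c hlt)
    · rfl
  · rintro rfl
    exact ⟨⟨i, rfl, (sameBlock_equivalence P).refl i⟩,
      fun k hk hik ↦ absurd (ho i rfl k hik) (not_le.2 hk)⟩

theorem isLast_insertLast_last (P : SetPartition n) (o : Option (Fin n)) :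
    IsLast (insertLast P o) (Fin.last n) :=
  fun j _ ↦ Fin.le_last j

theorem isLast_insertLast_castSucc {P : SetPartition n} {o : Option (Fin n)}
    (ho : ∀ c, o = some c → IsLast P c) (i : Fin n) :
    IsLast (insertLast P o) i.castSucc ↔ IsLast P i ∧ o ≠ some i := by
  simp only [IsLast, Fin.forall_fin_succ', sameBlock_insertLast_castSucc,
    Fin.castSucc_le_castSucc_iff, sameBlock_insertLast_castSucc_last]
  refine and_congr_right fun hi ↦ ?_
  simp only [(Fin.castSucc_lt_last i).not_ge, imp_false, not_iff_not]
  constructor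
  · rintro ⟨c, rfl, hc⟩
    rw [le_antisymm (hi c hc) (ho c rfl i ((sameBlock_equivalence P).symm hc))]
  · rintro rfl
    exact ⟨i, rfl, (sameBlock_equivalence P).refl i⟩

theorem eq_some_of_mem_map {P : SetPartition n} (o : Option {c // IsLast P c}) (c : Fin n)
    (h : o.map Subtype.val = some c) : IsLast P c := by
  obtain ⟨a, _, rfl⟩ := Option.map_eq_some_iff.1 h
  exact a.2

theorem insertLast_bijective (n : ℕ) : Function.Bijective
    (fun x : Σ P : SetPartition n, Option {c // IsLast P c} ↦
      insertLast x.1 (x.2.map Subtype.val)) := by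
  constructor
  · rintro ⟨P, o⟩ ⟨P', o'⟩ h
    simp only at h
    obtain rfl : P = P' := ext_sameBlock fun i j ↦ by
      rw [← sameBlock_insertLast_castSucc P (o.map Subtype.val), h, sameBlock_insertLast_castSucc]
    have : o.map Subtype.val = o'.map Subtype.val := Option.ext fun i ↦ by
      rw [← isArc_insertLast_last (eq_some_of_mem_map o), h,
        isArc_insertLast_last (eq_some_of_mem_map o')]
    rw [Option.map_injective Subtype.val_injective this]
  · intro Q
    have hQ := sameBlock_equivalence Q
    obtain ⟨P, hP⟩ := exists_sameBlock_iff (hQ.comap (Fin.castSucc (n := n)))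
    by_cases hex : ∃ i : Fin n, SameBlock Q i.castSucc (Fin.last n)
    · obtain ⟨c, hc, hmax⟩ := Set.exists_max_image
        {i : Fin n | SameBlock Q i.castSucc (Fin.last n)} id (Set.toFinite _) hex
      have hlast : IsLast P c := fun j hj ↦
        hmax j (hQ.trans (hQ.symm ((hP c j).1 hj)) hc)
      refine ⟨⟨P, some ⟨c, hlast⟩⟩, ext_sameBlock fun x y ↦ ?_⟩
      have hmid : ∀ i : Fin n, SameBlock P i c ↔ SameBlock Q i.castSucc (Fin.last n) :=
        fun i ↦ (hP i c).trans ⟨fun h ↦ hQ.trans h hc, fun h ↦ hQ.trans h (hQ.symm hc)⟩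
      rw [sameBlock_insertLast]
      induction x using Fin.lastCases <;> induction y using Fin.lastCases
      · simp [OptionRel, hQ.refl, (sameBlock_equivalence P).refl]
      · simpa [OptionRel] using ⟨fun h ↦ hQ.symm ((hmid _).1 ((sameBlock_equivalence P).symm h)),
          fun h ↦ (sameBlock_equivalence P).symm ((hmid _).2 (hQ.symm h))⟩
      · simpa [OptionRel] using hmid _
      · simpa [OptionRel] using hP _ _
    · push Not at hex
      refine ⟨⟨P, none⟩, ext_sameBlock fun x y ↦ ?_⟩
      rw [sameBlock_insertLast]
      induction x using Fin.lastCases <;> induction y using Fin.lastCases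
      · simp [OptionRel, hQ.refl]
      · simpa [OptionRel] using fun h ↦ hex _ (hQ.symm h)
      · simpa [OptionRel] using hex _
      · simpa [OptionRel] using hP _ _

open Classical in
theorem sum_insertLast {M : Type*} [AddCommMonoid M] (f : SetPartition (n + 1) → M) :
    ∑ Q, f Q = ∑ P : SetPartition n,
      (f (insertLast P none) + ∑ c with IsLast P c, f (insertLast P (some c))) := by
  rw [← (Equiv.ofBijective _ (insertLast_bijective n)).sum_comp, Fintype.sum_sigma]
  refine sum_congr rfl fun P _ ↦ ?_
  rw [Fintype.sum_option]
  congr 1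
  exact (sum_subtype _ (fun c ↦ by simp) fun c ↦ f (insertLast P (some c))).symm

end Insert

section Statistics

open Classical in
/-- The number of blocks, counted by their largest elements. -/
noncomputable def blockCount (P : SetPartition n) : ℕ := #{c | IsLast P c}

open Classical in
/-- The number of arcs passing strictly over `c`. -/
noncomputable def coverCount (P : SetPartition n) (c : Fin n) : ℚ :=
  ∑ i, ∑ j, if IsArc P i j ∧ i < c ∧ c < j then 1 else 0

open Classical in
/-- The number of pairs of an arc and a largest element of a block strictly below that arc. -/
noncomputable def lastCoverCount (P : SetPartition n) : ℚ :=
  ∑ c with IsLast P c, coverCount P c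

open Classical in
theorem inter_eq_sum (P : SetPartition n) : (inter P : ℚ) =
    ∑ i₁, ∑ j₁, ∑ i₂, ∑ j₂,
      if IsArc P i₁ j₁ ∧ IsArc P i₂ j₂ ∧ i₁ < i₂ ∧ i₂ < j₁ ∧ j₁ < j₂ then (1 : ℚ) else 0 := by
  rw [inter, Set.ncard_eq_toFinset_card', Set.toFinset_ofPred, Finset.card_filter]
  simp only [Fintype.sum_prod_type]
  push_cast
  rfl

theorem not_isArc_last (P : SetPartition (n + 1)) (j : Fin (n + 1)) :
    ¬ IsArc P (Fin.last n) j :=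
  fun h ↦ (Fin.le_last j).not_gt h.1

theorem coverCount_last (P : SetPartition (n + 1)) : coverCount P (Fin.last n) = 0 := by
  simp [coverCount, (Fin.le_last _).not_gt]

open Classical in
theorem coverCount_insertLast {P : SetPartition n} {o : Option (Fin n)}
    (ho : ∀ c, o = some c → IsLast P c) (k : Fin n) :
    coverCount (insertLast P o) k.castSucc =
      coverCount P k + ∑ i, if o = some i ∧ i < k then 1 else 0 := by
  simp only [coverCount, Fin.sum_univ_castSucc, not_isArc_last, isArc_insertLast_castSucc,
    isArc_insertLast_last ho, sum_add_distrib, Fin.castSucc_lt_castSucc_iff, Fin.castSucc_lt_last,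
    false_and, and_true, if_false, sum_const_zero, add_zero]

open Classical in
theorem inter_insertLast {P : SetPartition n} {o : Option (Fin n)}
    (ho : ∀ c, o = some c → IsLast P c) :
    (inter (insertLast P o) : ℚ) =
      inter P + ∑ c, if o = some c then coverCount P c else 0 := by
  simp only [inter_eq_sum, Fin.sum_univ_castSucc, not_isArc_last, isArc_insertLast_castSucc,
    isArc_insertLast_last ho, sum_add_distrib, Fin.castSucc_lt_castSucc_iff, Fin.castSucc_lt_last,
    (Fin.le_last _).not_gt, false_and, and_false, and_true, if_false, sum_const_zero,
    add_zero]
  congr 1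
  have : ∀ c, (if o = some c then coverCount P c else 0) =
      ∑ i, ∑ j, if IsArc P i j ∧ o = some c ∧ i < c ∧ c < j then 1 else 0 := fun c ↦ by
    split_ifs with h <;> simp [coverCount, h]
  simp only [this]
  conv_rhs => rw [sum_comm]
  exact sum_congr rfl fun i _ ↦ sum_comm

theorem forall_none_eq_some {P : SetPartition n} (c : Fin n) (h : none = some c) : IsLast P c := by
  cases h

theorem forall_some_eq_some {P : SetPartition n} {c : Fin n} (hc : IsLast P c) (k : Fin n)
    (h : some c = some k) : IsLast P k :=
  Option.some.inj h ▸ hc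

theorem blockCount_insertLast_none (P : SetPartition n) :
    blockCount (insertLast P none) = blockCount P + 1 := by
  classical
  rw [blockCount, card_filter, Fin.sum_univ_castSucc, ← card_filter,
    if_pos (isLast_insertLast_last _ _)]
  simp [isLast_insertLast_castSucc forall_none_eq_some, blockCount]

open Classical in
theorem filter_isLast_insertLast_some {P : SetPartition n} {c : Fin n} (hc : IsLast P c) :
    ({k | IsLast (insertLast P (some c)) k.castSucc} : Finset (Fin n)) =
      ({k | IsLast P k} : Finset (Fin n)).erase c := by
  ext k
  simp [isLast_insertLast_castSucc (forall_some_eq_some hc), and_comm, eq_comm]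

theorem blockCount_insertLast_some {P : SetPartition n} {c : Fin n} (hc : IsLast P c) :
    blockCount (insertLast P (some c)) = blockCount P := by
  classical
  rw [blockCount, card_filter, Fin.sum_univ_castSucc, ← card_filter,
    filter_isLast_insertLast_some hc, if_pos (isLast_insertLast_last _ _),
    card_erase_add_one (by simpa using hc), blockCount]

theorem inter_insertLast_none (P : SetPartition n) : inter (insertLast P none) = inter P := by
  have h := inter_insertLast (P := P) forall_none_eq_some
  simpa using h

theorem inter_insertLast_some {P : SetPartition n} {c : Fin n} (hc : IsLast P c) :
    (inter (insertLast P (some c)) : ℚ) = inter P + coverCount P c := by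
  simp [inter_insertLast (forall_some_eq_some hc)]

theorem lastCoverCount_insertLast_none (P : SetPartition n) :
    lastCoverCount (insertLast P none) = lastCoverCount P := by
  classical
  simp [lastCoverCount, sum_filter, Fin.sum_univ_castSucc, coverCount_last,
    isLast_insertLast_castSucc forall_none_eq_some, coverCount_insertLast forall_none_eq_some]

open Classical in
theorem lastCoverCount_insertLast_some {P : SetPartition n} {c : Fin n} (hc : IsLast P c) :
    lastCoverCount (insertLast P (some c)) = lastCoverCount P - coverCount P c +
      ∑ k with IsLast P k, if c < k then 1 else 0 := by
  have hmem : c ∈ ({k | IsLast P k} : Finset (Fin n)) := by simpa using hc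
  have hcov (k : Fin n) : coverCount (insertLast P (some c)) k.castSucc =
      coverCount P k + if c < k then 1 else 0 := by
    rw [coverCount_insertLast (forall_some_eq_some hc)]
    simp [ite_and]
  rw [lastCoverCount, sum_filter, Fin.sum_univ_castSucc, coverCount_last, ite_self, add_zero,
    ← sum_filter, filter_isLast_insertLast_some hc]
  simp only [hcov]
  rw [sum_add_distrib, sum_erase_eq_sub hmem, sum_erase _ (by simp), lastCoverCount]

theorem sum_sum_lt {α : Type*} [LinearOrder α] (s : Finset α) :
    ∑ a ∈ s, ∑ b ∈ s, (if a < b then (1 : ℚ) else 0) = (#s * #s - #s) / 2 := by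
  have hsymm : ∑ a ∈ s, ∑ b ∈ s, (if a < b then (1 : ℚ) else 0) =
      ∑ a ∈ s, ∑ b ∈ s, (if b < a then (1 : ℚ) else 0) := sum_comm
  have htotal : ∑ a ∈ s, ∑ b ∈ s, (if a < b then (1 : ℚ) else 0) +
      ∑ a ∈ s, ∑ b ∈ s, (if b < a then (1 : ℚ) else 0) = #s * #s - #s := by
    have hpair (a b : α) : ((if a < b then (1 : ℚ) else 0) + if b < a then 1 else 0) =
        1 - if a = b then 1 else 0 := by
      rcases lt_trichotomy a b with h | rfl | h
      · simp [h, h.not_gt, h.ne]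
      · simp
      · simp [h, h.not_gt, h.ne']
    simp only [← sum_add_distrib, hpair, sum_sub_distrib]
    simp
  linarith

open Classical in
theorem sum_lastCoverCount_insertLast (P : SetPartition n) :
    ∑ c with IsLast P c, lastCoverCount (insertLast P (some c)) =
      (blockCount P - 1) * lastCoverCount P +
        (blockCount P * blockCount P - blockCount P) / 2 := by
  rw [sum_congr rfl fun c hc ↦ lastCoverCount_insertLast_some (mem_filter.1 hc).2,
    sum_add_distrib, sum_sum_lt, sum_sub_distrib, sum_const, nsmul_eq_mul, ← blockCount,
    ← lastCoverCount]
  ring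

open Classical in
theorem sum_inter_insertLast (P : SetPartition n) :
    ∑ c with IsLast P c, (inter (insertLast P (some c)) : ℚ) =
      blockCount P * inter P + lastCoverCount P := by
  rw [sum_congr rfl fun c hc ↦ inter_insertLast_some (mem_filter.1 hc).2,
    sum_add_distrib, sum_const, nsmul_eq_mul, ← blockCount, ← lastCoverCount]

end Statistics

section BlockPolynomial

/-- The generating polynomial, by number of blocks, of a statistic on set partitions. -/
noncomputable def blockPoly (f : SetPartition n → ℚ) : ℚ[X] :=
  ∑ P, C (f P) * X ^ blockCount P

theorem X_mul_derivative_blockPoly (f : SetPartition n → ℚ) :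
    X * derivative (blockPoly f) = blockPoly fun P ↦ blockCount P * f P := by
  simp only [blockPoly, derivative_sum, mul_sum]
  refine sum_congr rfl fun P _ ↦ ?_
  rcases blockCount P with _ | k
  · simp
  · rw [derivative_C_mul, derivative_X_pow, C_mul, Nat.add_sub_cancel, pow_succ]
    ring

open Classical in
theorem blockPoly_succ (f : SetPartition (n + 1) → ℚ) :
    blockPoly f = X * blockPoly (fun P ↦ f (insertLast P none)) +
      blockPoly fun P ↦ ∑ c with IsLast P c, f (insertLast P (some c)) := by
  simp only [blockPoly, sum_insertLast, sum_add_distrib, blockCount_insertLast_none]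
  congr 1
  · rw [mul_sum]
    exact sum_congr rfl fun P _ ↦ by ring
  · refine sum_congr rfl fun P _ ↦ ?_
    rw [map_sum, sum_mul]
    exact sum_congr rfl fun c hc ↦ by rw [blockCount_insertLast_some (mem_filter.1 hc).2]

/-- The Touchard polynomial, the generating polynomial of set partitions by number of blocks. -/
noncomputable def touchard (n : ℕ) : ℚ[X] := blockPoly fun _ : SetPartition n ↦ 1

theorem touchard_succ (n : ℕ) : touchard (n + 1) = X * touchard n + X * derivative (touchard n) := by
  classical
  rw [touchard, blockPoly_succ, touchard, X_mul_derivative_blockPoly]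
  simp [blockCount]

theorem lastCoverCount_blockPoly_succ (n : ℕ) :
    blockPoly (lastCoverCount (n := n + 1)) =
      X * blockPoly (lastCoverCount (n := n)) +
      X * derivative (blockPoly (lastCoverCount (n := n))) - blockPoly (lastCoverCount (n := n)) +
      C (1 / 2) * X ^ 2 * derivative (derivative (touchard n)) := by
  classical
  have hsq : X ^ 2 * derivative (derivative (touchard n)) =
      blockPoly fun P : SetPartition n ↦ (blockCount P * blockCount P - blockCount P : ℚ) := by
    have h₁ := X_mul_derivative_blockPoly fun _ : SetPartition n ↦ 1
    have h₂ := X_mul_derivative_blockPoly fun P : SetPartition n ↦ (blockCount P * 1 : ℚ)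
    rw [← h₁, derivative_mul, derivative_X, one_mul] at h₂
    have h₃ : blockPoly (fun P : SetPartition n ↦ (blockCount P * blockCount P - blockCount P : ℚ)) =
        blockPoly (fun P : SetPartition n ↦ (blockCount P * (blockCount P * 1) : ℚ)) -
          blockPoly fun P : SetPartition n ↦ (blockCount P * 1 : ℚ) := by
      simp [blockPoly, sub_mul]
    rw [h₃, ← h₂, ← h₁, touchard]
    ring
  rw [mul_assoc, hsq, blockPoly_succ, X_mul_derivative_blockPoly]
  simp only [lastCoverCount_insertLast_none, sum_lastCoverCount_insertLast]
  rw [add_sub_assoc, add_assoc]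
  congr 1
  simp only [blockPoly, mul_sum, ← sum_sub_distrib, ← sum_add_distrib]
  refine sum_congr rfl fun P _ ↦ ?_
  rw [← mul_assoc, ← C_mul, ← sub_mul, ← C_sub, ← add_mul, ← C_add]
  ring_nf

theorem inter_blockPoly_succ (n : ℕ) :
    blockPoly (fun P : SetPartition (n + 1) ↦ (inter P : ℚ)) =
      X * blockPoly (fun P : SetPartition n ↦ (inter P : ℚ)) +
      X * derivative (blockPoly fun P : SetPartition n ↦ (inter P : ℚ)) +
      blockPoly (lastCoverCount (n := n)) := by
  classical
  rw [blockPoly_succ, X_mul_derivative_blockPoly]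
  simp only [inter_insertLast_none, sum_inter_insertLast]
  rw [add_assoc]
  congr 1
  simp [blockPoly, add_mul, sum_add_distrib]

theorem touchard_zero : touchard 0 = 1 := by
  have : Unique (SetPartition 0) :=
    { default := ⊤
      uniq := fun P ↦ ext_sameBlock fun i ↦ i.elim0 }
  simp [touchard, blockPoly, blockCount]

theorem touchard_one : touchard 1 = X := by
  rw [touchard_succ, touchard_zero, derivative_one]
  ring

theorem touchard_two : touchard 2 = X ^ 2 + X := by
  rw [touchard_succ, touchard_one, derivative_X]
  ring

theorem lastCoverCount_blockPoly (n : ℕ) :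
    2 * blockPoly (lastCoverCount (n := n)) =
      touchard (n + 2) - touchard (n + 1) - (X ^ 2 + 2 * (n : ℚ[X]) * X) * touchard n := by
  induction n with
  | zero =>
    have h₀ : blockPoly (lastCoverCount (n := 0)) = 0 := by simp [blockPoly, lastCoverCount]
    rw [h₀, touchard_two, touchard_one, touchard_zero]
    push_cast
    ring
  | succ n ih =>
    have hd := congrArg derivative ih
    have h₁ := touchard_succ n
    have h₃ := touchard_succ (n + 2)
    have hd₁ := congrArg derivative h₁
    have hC : (2 : ℚ[X]) * C (1 / 2) = 1 := by
      rw [← C_ofNat, ← C_mul]; norm_num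
    simp only [derivative_mul, derivative_sub, derivative_add, derivative_X, derivative_natCast,
      derivative_ofNat, derivative_X_pow, Nat.cast_ofNat, C_ofNat] at hd hd₁
    rw [lastCoverCount_blockPoly_succ]
    push_cast
    linear_combination (X - 1) * ih + X * hd +
      X ^ 2 * derivative (derivative (touchard n)) * hC - h₃ +
      (X ^ 2 + 2 * (n : ℚ[X]) * X + X + 1) * h₁ - X * hd₁

theorem inter_blockPoly (n : ℕ) :
    4 * blockPoly (fun P : SetPartition n ↦ (inter P : ℚ)) =
      (X ^ 2 + 4 * (n : ℚ[X]) * X - 2 * (n : ℚ[X])) * touchard n +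
        (4 * X + 2 * (n : ℚ[X]) + 5) * touchard (n + 1) - 5 * touchard (n + 2) := by
  induction n with
  | zero =>
    have h₀ : blockPoly (fun P : SetPartition 0 ↦ (inter P : ℚ)) = 0 := by
      simp [blockPoly, inter, Set.eq_empty_of_isEmpty]
    rw [h₀, touchard_two, touchard_one, touchard_zero]
    push_cast
    ring
  | succ n ih =>
    have hd := congrArg derivative ih
    have hA := lastCoverCount_blockPoly n
    have h₁ := touchard_succ n
    have h₂ := touchard_succ (n + 1)
    have h₃ := touchard_succ (n + 2)
    simp only [derivative_mul, derivative_sub, derivative_add, derivative_X, derivative_natCast,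
      derivative_ofNat, derivative_X_pow, Nat.cast_ofNat, C_ofNat] at hd
    rw [inter_blockPoly_succ]
    push_cast
    linear_combination X * ih + X * hd + 2 * hA -
      (X ^ 2 + 4 * (n : ℚ[X]) * X - 2 * (n : ℚ[X])) * h₁ -
      (4 * X + 2 * (n : ℚ[X]) + 5) * h₂ + 5 * h₃

theorem eval_one_blockPoly (f : SetPartition n → ℚ) : (blockPoly f).eval 1 = ∑ P, f P := by
  simp [blockPoly, eval_finsetSum]

theorem eval_one_touchard (n : ℕ) : (touchard n).eval 1 = bell n := by
  simp [touchard, eval_one_blockPoly, bell]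

end BlockPolynomial

end SetPartition

/-- `Σ_{λ ∈ Π(n)} i(λ) = (1/4)((2n+1)B_n + (2n+9)B_{n+1} - 5B_{n+2})`. -/
theorem sum_inter (n : ℕ) (hn : 1 ≤ n) :
    (∑ P : SetPartition n, (inter P : ℚ)) =
      (1 / 4) * ((2 * (n : ℚ) + 1) * bell n + (2 * (n : ℚ) + 9) * bell (n + 1)
        - 5 * bell (n + 2)) := by
  have h := congrArg (eval 1) (SetPartition.inter_blockPoly n)
  simp only [eval_mul, eval_add, eval_sub, eval_pow, eval_X, eval_natCast, eval_ofNat, one_pow,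
    SetPartition.eval_one_blockPoly, SetPartition.eval_one_touchard] at h
  linarith
end

section
/- For all integers n ≥ 0: B_{3n} ≡ 1 (mod 2), B_{3n+1} ≡ 1 (mod 2), and B_{3n+2} ≡ 0 (mod 2); that is, the Bell numbers modulo 2 are periodic with period 3, with pattern 1, 1, 0. -/
open Finset

/-- A finpartition of a finite type is determined by the part of each element. -/
theorem Finpartition.ext_part {α : Type*} [Fintype α] [DecidableEq α]
    {P Q : Finpartition (univ : Finset α)} (h : ∀ a, P.part a = Q.part a) : P = Q := by
  have key (R : Finpartition (univ : Finset α)) (b : Finset α) :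
      b ∈ R.parts ↔ ∃ a, R.part a = b := by
    constructor
    · intro hb
      obtain ⟨a, -, ha⟩ := R.part_surjOn hb
      exact ⟨a, ha⟩
    · rintro ⟨a, rfl⟩
      exact R.part_mem.2 (mem_univ a)
  ext b
  simp only [key, h]

open Classical in
/-- Finpartitions of a finite type correspond to equivalence relations on it. -/
noncomputable def Finpartition.equivSetoid (α : Type*) [Fintype α] [DecidableEq α] :
    Finpartition (univ : Finset α) ≃ Setoid α where
  toFun P := Setoid.ker P.part
  invFun s := Finpartition.ofSetoid s
  left_inv P := by
    refine Finpartition.ext_part fun a ↦ ?_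
    ext b
    rw [Finpartition.mem_part_ofSetoid_iff_rel, Setoid.ker_def,
      P.mem_part_iff_part_eq_part (mem_univ b) (mem_univ a)]
    exact eq_comm
  right_inv s := by
    ext a b
    rw [Setoid.ker_def, ← Finpartition.mem_part_ofSetoid_iff_rel (s := s),
      Finpartition.mem_part_iff_part_eq_part _ (mem_univ b) (mem_univ a)]
    exact eq_comm

instance Setoid.finite (α : Type*) [Finite α] : Finite (Setoid α) :=
  Finite.of_injective (fun s : Setoid α ↦ (fun a b ↦ s a b : α → α → Prop)) fun _ _ h ↦
    Setoid.ext fun a b ↦ iff_of_eq (congrFun (congrFun h a) b)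

/-- Relabelling along an equivalence of types transports equivalence relations. -/
def Setoid.congrEquiv {α β : Type*} (e : α ≃ β) : Setoid α ≃ Setoid β where
  toFun s := s.comap e.symm
  invFun s := s.comap e
  left_inv s := by ext; simp [Setoid.comap_rel]
  right_inv s := by ext; simp [Setoid.comap_rel]

theorem Setoid.natCard_fin (n : ℕ) : Nat.card (Setoid (Fin n)) = bell n := by
  rw [bell, ← Nat.card_eq_fintype_card]
  exact Nat.card_congr (Finpartition.equivSetoid (Fin n)).symm

theorem Setoid.natCard_eq_bell (α : Type*) [Finite α] :
    Nat.card (Setoid α) = bell (Nat.card α) := by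
  rw [← Setoid.natCard_fin]
  exact Nat.card_congr (Setoid.congrEquiv (Finite.equivFin α))

/-- Equivalence relations identifying the two added points correspond to equivalence relations
with a single added point. -/
def Setoid.equivOfRelNone (α : Type*) :
    {s : Setoid (Option (Option α)) // s none (some none)} ≃ Setoid (Option α) where
  toFun s := s.1.comap some
  invFun t := ⟨t.comap fun x ↦ x.getD none, t.refl none⟩
  left_inv := by
    rintro ⟨s, hs⟩
    have key (x : Option (Option α)) : s (some (x.getD none)) x := by
      cases x with
      | none => exact s.symm hs
      | some x => exact s.refl _
    ext x y
    exact ⟨fun h ↦ s.trans (s.symm (key x)) (s.trans h (key y)),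
      fun h ↦ s.trans (key x) (s.trans h (s.symm (key y)))⟩
  right_inv _ := rfl

/-- Extend an equivalence relation by a new singleton class. -/
def Setoid.addSingleton {α : Type*} (t : Setoid α) : Setoid (Option α) where
  r x y := Option.Rel t x y
  iseqv :=
    { refl := by rintro (_ | x); exacts [.none, .some (t.refl x)]
      symm := by rintro _ _ (h | _); exacts [.some (t.symm h), .none]
      trans := by
        rintro _ _ _ (hxy | _) (hyz | _)
        exacts [.some (t.trans hxy hyz), .none] }

theorem Setoid.addSingleton_some_some {α : Type*} (t : Setoid α) (x y : α) :
    t.addSingleton (some x) (some y) ↔ t x y :=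
  ⟨fun | .some h => h, .some⟩

theorem Setoid.not_addSingleton_none_some {α : Type*} (t : Setoid α) (x : α) :
    ¬ t.addSingleton none (some x) := nofun

theorem Setoid.not_addSingleton_some_none {α : Type*} (t : Setoid α) (x : α) :
    ¬ t.addSingleton (some x) none := nofun

/-- Equivalence relations in which the added point is isolated correspond to equivalence
relations without it. -/
def Setoid.equivOfIsolated (α : Type*) :
    {s : Setoid (Option α) // ∀ x, ¬ s none (some x)} ≃ Setoid α where
  toFun s := s.1.comap some
  invFun t := ⟨t.addSingleton, t.not_addSingleton_none_some⟩
  left_inv := by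
    rintro ⟨s, hs⟩
    apply Subtype.ext
    ext (_ | x) (_ | y)
    · exact iff_of_true (Setoid.refl' _ _) (s.refl _)
    · exact iff_of_false (Setoid.not_addSingleton_none_some _ y) (hs y)
    · exact iff_of_false (Setoid.not_addSingleton_some_none _ x) fun h ↦ hs x (s.symm h)
    · exact Setoid.addSingleton_some_some _ x y
  right_inv t := by
    ext x y
    exact t.addSingleton_some_some x y

/-- Equivalence relations in which both added points are isolated correspond to equivalence
relations without them. -/
def Setoid.equivOfIsolatedPair (α : Type*) :
    {s : Setoid (Option (Option α)) //
      (∀ x, ¬ s none (some x)) ∧ ∀ x, ¬ s (some none) (some (some x))} ≃ Setoid α :=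
  (Equiv.subtypeSubtypeEquivSubtypeInter (fun s : Setoid (Option (Option α)) ↦
      ∀ x, ¬ s none (some x)) fun s ↦ ∀ x, ¬ s (some none) (some (some x))).symm.trans <|
    ((Setoid.equivOfIsolated (Option α)).subtypeEquiv fun _ ↦ Iff.rfl).trans
      (Setoid.equivOfIsolated α)

/-- Exchanging the two added points. -/
def swapNone (α : Type*) : Option (Option α) → Option (Option α)
  | none => some none
  | some none => none
  | some (some x) => some (some x)

theorem swapNone_involutive (α : Type*) : Function.Involutive (swapNone α) := by
  rintro (_ | _ | x) <;> rfl

/-- An equivalence relation is invariant under exchanging the two added points iff these are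
related or both isolated. -/
theorem Setoid.comap_swapNone_eq_iff {α : Type*} (s : Setoid (Option (Option α))) :
    s.comap (swapNone α) = s ↔ s none (some none) ∨
      ((∀ x, ¬ s none (some x)) ∧ ∀ x, ¬ s (some none) (some (some x))) := by
  constructor
  · intro h
    by_cases hs : s none (some none)
    · exact .inl hs
    have key (x : α) : s (some none) (some (some x)) ↔ s none (some (some x)) :=
      iff_of_eq (congrArg (fun t ↦ t none (some (some x))) h)
    have hnone (x : α) : ¬ s none (some (some x)) := fun hx ↦
      hs (s.trans hx (s.symm ((key x).2 hx)))
    refine .inr ⟨?_, fun x hx ↦ hnone x ((key x).1 hx)⟩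
    rintro (_ | x)
    exacts [hs, hnone x]
  · rintro (hs | ⟨h₁, h₂⟩)
    · have key (x : Option (Option α)) : s (swapNone α x) x := by
        rcases x with _ | _ | x
        exacts [s.symm hs, hs, s.refl _]
      ext x y
      exact ⟨fun h ↦ s.trans (s.symm (key x)) (s.trans h (key y)),
        fun h ↦ s.trans (key x) (s.trans h (s.symm (key y)))⟩
    · have hleft (x : Option α) : ¬ s (some x) none := fun h ↦ h₁ x (s.symm h)
      have hright (x : α) : ¬ s (some (some x)) (some none) := fun h ↦ h₂ x (s.symm h)
      ext x y
      rcases x with _ | _ | x <;> rcases y with _ | _ | y <;>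
        simp [Setoid.comap_rel, swapNone, h₁, hleft, h₂, hright]

/-- Touchard's congruence modulo `2`, for equivalence relations. -/
theorem Setoid.natCard_option_option_modEq (α : Type*) [Finite α] :
    Nat.card (Setoid (Option (Option α))) ≡
      Nat.card (Setoid (Option α)) + Nat.card (Setoid α) [MOD 2] := by
  classical
  have := Fintype.ofFinite (Setoid (Option (Option α)))
  let f : Function.End (Setoid (Option (Option α))) := fun s ↦ s.comap (swapNone α)
  have hf : f ^ 2 ^ 1 = 1 := by
    funext s
    ext x y
    change s (swapNone α (swapNone α x)) (swapNone α (swapNone α y)) ↔ s x y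
    rw [swapNone_involutive α x, swapNone_involutive α y]
  have hmod := Equiv.Perm.card_fixedPoints_modEq hf
  rw [← Nat.card_eq_fintype_card, ← Nat.card_eq_fintype_card] at hmod
  have hcard : Nat.card (Function.fixedPoints f) =
      Nat.card (Setoid (Option α)) + Nat.card (Setoid α) := by
    rw [← Nat.card_congr (Setoid.equivOfRelNone α),
      ← Nat.card_congr (Setoid.equivOfIsolatedPair α), ← Nat.card_sum]
    refine Nat.card_congr ((Equiv.subtypeEquivRight Setoid.comap_swapNone_eq_iff).trans
      (subtypeOrEquiv _ _ ?_))
    rw [Pi.disjoint_iff]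
    intro s
    rw [Prop.disjoint_iff]
    by_contra! h
    exact h.2.1 none h.1
  rwa [hcard] at hmod

/-- Touchard's congruence modulo `2`. -/
theorem bell_add_two_modEq (n : ℕ) : bell (n + 2) ≡ bell (n + 1) + bell n [MOD 2] := by
  simpa [Setoid.natCard_eq_bell] using Setoid.natCard_option_option_modEq (Fin n)

theorem bell_eq_one_of_le_one {n : ℕ} (hn : n ≤ 1) : bell n = 1 := by
  have : Subsingleton (Fin n) := Fin.subsingleton_iff_le_one.2 hn
  rw [← Setoid.natCard_fin, Nat.card_eq_one_iff_unique]
  exact ⟨⟨fun s t ↦ Setoid.ext fun a b ↦ by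
    obtain rfl := Subsingleton.elim a b
    exact iff_of_true (s.refl a) (t.refl a)⟩, ⟨⊤⟩⟩

/-- The Bell numbers modulo 2 are periodic with period 3, with pattern `1, 1, 0`. -/
theorem bell_mod_two (n : ℕ) :
    bell (3 * n) % 2 = 1 ∧ bell (3 * n + 1) % 2 = 1 ∧ bell (3 * n + 2) % 2 = 0 := by
  induction n with
  | zero =>
    have h := bell_add_two_modEq 0
    rw [bell_eq_one_of_le_one le_rfl, bell_eq_one_of_le_one zero_le_one] at h
    exact ⟨by simp [bell_eq_one_of_le_one], by simp [bell_eq_one_of_le_one], h⟩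
  | succ n ih =>
    have h₀ := bell_add_two_modEq (3 * n + 1)
    have h₁ := bell_add_two_modEq (3 * n + 2)
    have h₂ := bell_add_two_modEq (3 * n + 3)
    simp only [Nat.ModEq, add_assoc, Nat.reduceAdd] at h₀ h₁ h₂
    simp only [mul_add, add_assoc, mul_one, Nat.reduceAdd]
    omega
end
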